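/- arXiv:2604.00591 — 3 statements merged into one kernel-verified Lean document; each statement's English description precedes it below -/
import Mathlib

section
/- Let q be a prime power and let C₁*(n, q) be the set of A ∈ M(n, F_q) whose characteristic polynomial factors as f₀(t)·(t − λ) for some nonzero λ ∈ F_q^×, with f₀ monic of degree n−1 having no roots in F_q. Define α*(n, q) := |C₁*(n, q)| / q^{n²}. Then α*(n, q) = v(GL, n−1, q)·c_n(q), the limit α*(∞, q) := lim_{n→∞} α*(n, q) equals c(q)^q > e^{−23/9}, and for every n > 5(q−1)², |α*(∞, q) − α*(n+1, q)| ≤ (1/2)·16^{q−1}·q^{−(n+1)(n+q)/(2(q−1))} + 4·q^{−(n+1)}. -/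
open Matrix Polynomial Filter

/-- `v(GL, r, q)`: the proportion of eigenvalue-free matrices (characteristic polynomial with
no roots in `F`) in `GL(r, F)`.  (For `r = 0` this equals `1`.) -/
noncomputable def vGL (F : Type*) [Field F] [Fintype F] (r : ℕ) : ℝ :=
  (Nat.card {A : (Matrix (Fin r) (Fin r) F)ˣ //
      ∀ t : F, ((A.val : Matrix (Fin r) (Fin r) F).charpoly).eval t ≠ 0} : ℝ)
    / (Nat.card (Matrix (Fin r) (Fin r) F)ˣ : ℝ)

/-- `α*(n, q) := |C₁*(n, q)| / q^{n²}`, where `C₁*(n, q)` is the set of matrices in `M(n, F_q)`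
whose characteristic polynomial factors as `f₀(t)·(t − λ)` with `λ ∈ F_q^×` nonzero and `f₀`
monic of degree `n − 1` with no roots in `F_q`. -/
noncomputable def alphaStar (F : Type*) [Field F] [Fintype F] (q n : ℕ) : ℝ :=
  (Nat.card {A : Matrix (Fin n) (Fin n) F //
      ∃ (lam : F) (f₀ : Polynomial F), lam ≠ 0 ∧ f₀.Monic ∧ f₀.natDegree = n - 1 ∧
        (∀ t : F, f₀.eval t ≠ 0) ∧ A.charpoly = f₀ * (X - C lam)} : ℝ)
    / (q : ℝ) ^ (n ^ 2)

theorem coe_aeval_restrict {R M : Type*} [CommRing R] [AddCommGroup M] [Module R M]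
    (φ : Module.End R M) {U : Submodule R M} (h : ∀ x ∈ U, φ x ∈ U) (p : R[X]) (x : U) :
    ((aeval (φ.restrict h) p x : U) : M) = aeval φ p x := by
  induction p using Polynomial.induction_on' generalizing x with
  | add p q hp hq => simp [hp, hq]
  | monomial n a =>
    simp only [aeval_monomial, Module.End.mul_apply, Module.algebraMap_end_apply,
      Submodule.coe_smul]
    rw [Module.End.pow_restrict]
    rfl

theorem charpoly_eq_X_sub_C_pow {K V : Type*} [Field K] [AddCommGroup V] [Module K V]
    [FiniteDimensional K V] (φ : Module.End K V) (μ : K) (k : ℕ)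
    (h : aeval φ ((X - C μ) ^ k) = 0) :
    LinearMap.charpoly φ = (X - C μ) ^ Module.finrank K V := by
  have h1 : LinearMap.charpoly (φ - μ • 1) = X ^ Module.finrank K V := by
    have h2 := (LinearMap.charpoly_nilpotent_tfae (φ - μ • 1)).out 0 1
    refine h2.mp ⟨k, ?_⟩
    rw [← h]
    simp [Algebra.algebraMap_eq_smul_one]
  rw [LinearMap.charpoly_sub_smul] at h1
  have h2 := congrArg (fun p => p.comp (X - C μ)) h1
  simpa [comp_assoc] using h2

theorem eval_charpoly_ne_zero_of_aeval_eq_zero {K V : Type*} [Field K] [AddCommGroup V] [Module K V]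
    [FiniteDimensional K V] (φ : Module.End K V) (μ : K) (g : K[X]) (hg : g.eval μ ≠ 0)
    (h : aeval φ g = 0) : (LinearMap.charpoly φ).eval μ ≠ 0 := by
  intro h0
  have h1 : φ.HasEigenvalue μ := (Module.End.hasEigenvalue_iff_isRoot_charpoly φ μ).2 h0
  have h2 := Module.End.isRoot_of_hasEigenvalue h1
  exact hg (h2.dvd (minpoly.dvd K φ h))

theorem isCoprime_X_sub_C_pow {K : Type*} [Field K] (μ : K) (k : ℕ) (g : K[X])
    (hg : g.eval μ ≠ 0) : IsCoprime ((X - C μ) ^ k) g := by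
  refine IsCoprime.pow_left ?_
  rw [(irreducible_X_sub_C μ).coprime_iff_not_dvd, dvd_iff_isRoot]
  exact hg

theorem X_sub_C_pow_mul_inj {K : Type*} [Field K] {μ : K} {k l : ℕ} {g h : K[X]}
    (hg : g.eval μ ≠ 0) (hh : h.eval μ ≠ 0) (e : (X - C μ) ^ k * g = (X - C μ) ^ l * h) :
    k = l ∧ g = h := by
  have key : ∀ (k : ℕ) {g : K[X]}, g.eval μ ≠ 0 →
      rootMultiplicity μ ((X - C μ) ^ k * g) = k := by
    intro k g hg
    have hg0 : g ≠ 0 := by rintro rfl; simp at hg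
    rw [rootMultiplicity_mul (mul_ne_zero (pow_ne_zero _ (X_sub_C_ne_zero μ)) hg0),
      rootMultiplicity_X_sub_C_pow, rootMultiplicity_eq_zero hg, add_zero]
  have hkl : k = l := by rw [← key k hg, e, key l hh]
  subst hkl
  exact ⟨rfl, mul_left_cancel₀ (pow_ne_zero _ (X_sub_C_ne_zero μ)) e⟩

theorem exists_conj_fromBlocks {K : Type*} [Field K] {k m : ℕ} (μ : K) (g : K[X])
    (hg : g.eval μ ≠ 0) (A : Matrix (Fin k ⊕ Fin m) (Fin k ⊕ Fin m) K)
    (hA : A.charpoly = (X - C μ) ^ k * g) :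
    ∃ (P : (Matrix (Fin k ⊕ Fin m) (Fin k ⊕ Fin m) K)ˣ) (B : Matrix (Fin k) (Fin k) K)
      (D : Matrix (Fin m) (Fin m) K), B.charpoly = (X - C μ) ^ k ∧ D.charpoly = g ∧
        P.val * fromBlocks B 0 0 D * P⁻¹.val = A := by
  set φ : Module.End K (Fin k ⊕ Fin m → K) := Matrix.toLin' A with hφ
  have hφc : LinearMap.charpoly φ = (X - C μ) ^ k * g := by rw [hφ, Matrix.charpoly_toLin', hA]
  have hcop := isCoprime_X_sub_C_pow μ k g hg
  set U := LinearMap.ker (aeval φ ((X - C μ) ^ k)) with hU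
  set W := LinearMap.ker (aeval φ g) with hW
  have hUW : IsCompl U W := by
    refine ⟨disjoint_ker_aeval_of_isCoprime φ hcop, ?_⟩
    rw [codisjoint_iff, hU, hW, sup_ker_aeval_eq_ker_aeval_mul_of_coprime φ hcop, ← hφc,
      LinearMap.aeval_self_charpoly, LinearMap.ker_zero]
  have hinv : ∀ (p : K[X]), ∀ x ∈ LinearMap.ker (aeval φ p), φ x ∈ LinearMap.ker (aeval φ p) := by
    intro p x hx
    rw [LinearMap.mem_ker] at hx ⊢
    have : aeval φ p * φ = φ * aeval φ p := by
      have := congrArg (aeval φ) (mul_comm p X)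
      simpa using this
    have h3 := LinearMap.congr_fun this x
    simpa [hx] using h3
  let φU := φ.restrict (hinv ((X - C μ) ^ k))
  let φW := φ.restrict (hinv g)
  have hφU : aeval φU ((X - C μ) ^ k) = 0 := by
    ext x
    have := coe_aeval_restrict φ (hinv ((X - C μ) ^ k)) ((X - C μ) ^ k) x
    rw [this, x.2]; rfl
  have hφW : aeval φW g = 0 := by
    ext x
    have := coe_aeval_restrict φ (hinv g) g x
    rw [this, x.2]; rfl
  let e := Submodule.prodEquivOfIsCompl U W hUW
  have hconj : e.conj (φU.prodMap φW) = φ := by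
    apply LinearMap.ext
    intro x
    obtain ⟨y, rfl⟩ := e.surjective x
    simp [LinearEquiv.conj_apply, e, φU, φW]
  have hcp : LinearMap.charpoly φU * LinearMap.charpoly φW = (X - C μ) ^ k * g := by
    rw [← LinearMap.charpoly_prodMap, ← LinearEquiv.charpoly_conj e, hconj, hφc]
  rw [charpoly_eq_X_sub_C_pow φU μ k hφU] at hcp
  obtain ⟨hk, hgW⟩ := X_sub_C_pow_mul_inj (eval_charpoly_ne_zero_of_aeval_eq_zero φW μ g hg hφW)
    hg hcp
  have hm : Module.finrank K W = m := by
    have h1 := Submodule.finrank_add_eq_of_isCompl hUW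
    rw [hk] at h1
    simpa using h1
  let bU := Module.finBasisOfFinrankEq K U hk
  let bW := Module.finBasisOfFinrankEq K W hm
  let b := (bU.prod bW).map e
  let s := Pi.basisFun K (Fin k ⊕ Fin m)
  refine ⟨⟨s.toMatrix b, b.toMatrix s, by simp, by simp⟩, LinearMap.toMatrix bU bU φU,
    LinearMap.toMatrix bW bW φW, ?_, ?_, ?_⟩
  · rw [LinearMap.charpoly_toMatrix, charpoly_eq_X_sub_C_pow φU μ k hφU, hk]
  · rw [LinearMap.charpoly_toMatrix, hgW]
  · have h2 : LinearMap.toMatrix b b φ =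
        fromBlocks (LinearMap.toMatrix bU bU φU) 0 0 (LinearMap.toMatrix bW bW φW) := by
      rw [← LinearMap.toMatrix_prodMap]
      ext i j
      simp [LinearMap.toMatrix_apply, b, ← hconj, LinearEquiv.conj_apply]
    change s.toMatrix b * _ * b.toMatrix s = A
    rw [← h2, basis_toMatrix_mul_linearMap_toMatrix_mul_basis_toMatrix,
      LinearMap.toMatrix_eq_toMatrix', hφ, LinearMap.toMatrix'_toLin']

theorem mul_pow_eq_pow_mul {K ι κ : Type*} [CommRing K] [Fintype ι] [Fintype κ] [DecidableEq ι]
    [DecidableEq κ] {R : Matrix ι κ K} {M : Matrix κ κ K} {N : Matrix ι ι K}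
    (h : R * M = N * R) (j : ℕ) : R * M ^ j = N ^ j * R := by
  induction j with
  | zero => simp
  | succ j ih =>
    rw [pow_succ, ← Matrix.mul_assoc, ih, Matrix.mul_assoc, h, ← Matrix.mul_assoc, ← pow_succ]

theorem isUnit_scalar_sub {K κ : Type*} [Field K] [Fintype κ] [DecidableEq κ] {D : Matrix κ κ K}
    {μ : K} (hD : D.charpoly.eval μ ≠ 0) : IsUnit (scalar κ μ - D) := by
  rw [Matrix.isUnit_iff_isUnit_det, ← Matrix.eval_charpoly]
  exact isUnit_iff_ne_zero.2 hD

theorem scalar_sub_pow_eq_zero {K ι : Type*} [Field K] [Fintype ι] [DecidableEq ι]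
    {B : Matrix ι ι K} {μ : K} {k : ℕ} (hB : B.charpoly = (X - C μ) ^ k) :
    (scalar ι μ - B) ^ k = 0 := by
  have h := Matrix.aeval_self_charpoly B
  rw [hB] at h
  simp only [map_pow, map_sub, aeval_X, aeval_C] at h
  rw [← neg_sub, neg_pow]
  have h2 : (algebraMap K (Matrix ι ι K)) μ = scalar ι μ := rfl
  rw [← h2, h, mul_zero]

theorem exists_eq_fromBlocks_diagonal {K ι κ : Type*} [Field K] [Fintype ι] [Fintype κ]
    [DecidableEq ι] [DecidableEq κ] {μ : K} {k : ℕ} {B B' : Matrix ι ι K} {D D' : Matrix κ κ K}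
    (hB : B.charpoly = (X - C μ) ^ k) (hB' : B'.charpoly = (X - C μ) ^ k)
    (hD : D.charpoly.eval μ ≠ 0) (hD' : D'.charpoly.eval μ ≠ 0) {R : Matrix (ι ⊕ κ) (ι ⊕ κ) K}
    (h : R * fromBlocks B 0 0 D = fromBlocks B' 0 0 D' * R) :
    ∃ a d, R = fromBlocks a 0 0 d := by
  refine ⟨R.toBlocks₁₁, R.toBlocks₂₂, ?_⟩
  rw [← fromBlocks_toBlocks R, fromBlocks_multiply, fromBlocks_multiply, fromBlocks_inj] at h
  simp only [Matrix.mul_zero, Matrix.zero_mul, add_zero, zero_add] at h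
  obtain ⟨-, h12, h21, -⟩ := h
  have e12 : R.toBlocks₁₂ = 0 := by
    have h1 : R.toBlocks₁₂ * (scalar κ μ - D) = (scalar ι μ - B') * R.toBlocks₁₂ := by
      rw [Matrix.mul_sub, Matrix.sub_mul, h12]; congr 1; ext; simp [mul_comm]
    have h2 := mul_pow_eq_pow_mul h1 k
    rw [scalar_sub_pow_eq_zero hB', Matrix.zero_mul] at h2
    obtain ⟨u, hu⟩ := (isUnit_scalar_sub hD).pow k
    rw [← hu] at h2
    have h3 := congrArg (fun M => M * u⁻¹.val) h2
    simpa [Matrix.mul_assoc, -Matrix.coe_units_inv] using h3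
  have e21 : R.toBlocks₂₁ = 0 := by
    have h1 : R.toBlocks₂₁ * (scalar ι μ - B) = (scalar κ μ - D') * R.toBlocks₂₁ := by
      rw [Matrix.mul_sub, Matrix.sub_mul, h21]; congr 1; ext; simp [mul_comm]
    have h2 := mul_pow_eq_pow_mul h1 k
    rw [scalar_sub_pow_eq_zero hB, Matrix.mul_zero] at h2
    obtain ⟨u, hu⟩ := (isUnit_scalar_sub hD').pow k
    rw [← hu] at h2
    have h3 := congrArg (fun M => u⁻¹.val * M) h2
    simpa [← Matrix.mul_assoc, -Matrix.coe_units_inv] using h3.symm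
  rw [← e12, ← e21, fromBlocks_toBlocks]

/-- The block-diagonal invertible matrix with the given invertible diagonal blocks. -/
def blockUnit {K ι κ : Type*} [CommRing K] [Fintype ι] [Fintype κ] [DecidableEq ι] [DecidableEq κ]
    (a : (Matrix ι ι K)ˣ) (d : (Matrix κ κ K)ˣ) : (Matrix (ι ⊕ κ) (ι ⊕ κ) K)ˣ where
  val := fromBlocks a.val 0 0 d.val
  inv := fromBlocks a⁻¹.val 0 0 d⁻¹.val
  val_inv := by rw [fromBlocks_multiply, Units.mul_inv, Units.mul_inv]; simp
  inv_val := by rw [fromBlocks_multiply, Units.inv_mul, Units.inv_mul]; simp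

theorem blockUnit_conj {K ι κ : Type*} [CommRing K] [Fintype ι] [Fintype κ] [DecidableEq ι]
    [DecidableEq κ] (a : (Matrix ι ι K)ˣ) (d : (Matrix κ κ K)ˣ) (B : Matrix ι ι K)
    (D : Matrix κ κ K) :
    fromBlocks (a.val * B * a⁻¹.val) 0 0 (d.val * D * d⁻¹.val) =
      (blockUnit a d).val * fromBlocks B 0 0 D * (blockUnit a d)⁻¹.val := by
  change _ = fromBlocks a.val 0 0 d.val * fromBlocks B 0 0 D * fromBlocks a⁻¹.val 0 0 d⁻¹.val
  rw [fromBlocks_multiply, fromBlocks_multiply]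
  simp [-Matrix.coe_units_inv]

theorem blockUnit_inj {K ι κ : Type*} [CommRing K] [Fintype ι] [Fintype κ] [DecidableEq ι]
    [DecidableEq κ] {a a' : (Matrix ι ι K)ˣ} {d d' : (Matrix κ κ K)ˣ}
    (h : blockUnit a d = blockUnit a' d') : a = a' ∧ d = d' := by
  have h1 := congrArg Units.val h
  change fromBlocks a.val 0 0 d.val = fromBlocks a'.val 0 0 d'.val at h1
  rw [fromBlocks_inj] at h1
  exact ⟨Units.ext h1.1, Units.ext h1.2.2.2⟩

theorem exists_eq_blockUnit {K ι κ : Type*} [Field K] [Fintype ι] [Fintype κ]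
    [DecidableEq ι] [DecidableEq κ] {μ : K} {k : ℕ} {B B' : Matrix ι ι K} {D D' : Matrix κ κ K}
    (hB : B.charpoly = (X - C μ) ^ k) (hB' : B'.charpoly = (X - C μ) ^ k)
    (hD : D.charpoly.eval μ ≠ 0) (hD' : D'.charpoly.eval μ ≠ 0)
    {R : (Matrix (ι ⊕ κ) (ι ⊕ κ) K)ˣ}
    (h : R.val * fromBlocks B 0 0 D * R⁻¹.val = fromBlocks B' 0 0 D') :
    ∃ a d, R = blockUnit a d := by
  have h1 : R.val * fromBlocks B 0 0 D = fromBlocks B' 0 0 D' * R.val := by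
    rw [← h, Matrix.mul_assoc _ _ R.val, Units.inv_mul, Matrix.mul_one]
  have h2 : R⁻¹.val * fromBlocks B' 0 0 D' = fromBlocks B 0 0 D * R⁻¹.val := by
    rw [← h, ← Matrix.mul_assoc, ← Matrix.mul_assoc, Units.inv_mul, Matrix.one_mul]
  obtain ⟨a, d, had⟩ := exists_eq_fromBlocks_diagonal hB hB' hD hD' h1
  obtain ⟨a', d', had'⟩ := exists_eq_fromBlocks_diagonal hB' hB hD' hD h2
  have h3 := R.mul_inv
  have h4 := R.inv_mul
  rw [had, had', fromBlocks_multiply, ← fromBlocks_one, fromBlocks_inj] at h3 h4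
  simp only [Matrix.mul_zero, Matrix.zero_mul, add_zero, zero_add] at h3 h4
  exact ⟨⟨a, a', h3.1, h4.1⟩, ⟨d, d', h3.2.2.2, h4.2.2.2⟩, Units.ext had⟩

theorem card_charpoly_split {K : Type*} [Field K] [Fintype K] (μ : K) (k m : ℕ) (G : K[X] → Prop)
    (hG : ∀ g, G g → g.eval μ ≠ 0) :
    Nat.card {A : Matrix (Fin k ⊕ Fin m) (Fin k ⊕ Fin m) K //
        ∃ g, G g ∧ A.charpoly = (X - C μ) ^ k * g} *
      (Nat.card (Matrix (Fin k) (Fin k) K)ˣ * Nat.card (Matrix (Fin m) (Fin m) K)ˣ) =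
    Nat.card (Matrix (Fin k ⊕ Fin m) (Fin k ⊕ Fin m) K)ˣ *
      (Nat.card {B : Matrix (Fin k) (Fin k) K // B.charpoly = (X - C μ) ^ k} *
        Nat.card {D : Matrix (Fin m) (Fin m) K // G D.charpoly}) := by
  rw [← Nat.card_prod, ← Nat.card_prod, ← Nat.card_prod, ← Nat.card_prod]
  have hs : ∀ A : {A : Matrix (Fin k ⊕ Fin m) (Fin k ⊕ Fin m) K //
      ∃ g, G g ∧ A.charpoly = (X - C μ) ^ k * g},
      ∃ (P : (Matrix (Fin k ⊕ Fin m) (Fin k ⊕ Fin m) K)ˣ)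
        (B : {B : Matrix (Fin k) (Fin k) K // B.charpoly = (X - C μ) ^ k})
        (D : {D : Matrix (Fin m) (Fin m) K // G D.charpoly}),
        P.val * fromBlocks B.val 0 0 D.val * P⁻¹.val = A.val := by
    rintro ⟨A, g, hg, hA⟩
    obtain ⟨P, B, D, hB, hD, h⟩ := exists_conj_fromBlocks μ g (hG g hg) A hA
    exact ⟨P, ⟨B, hB⟩, ⟨D, by rwa [hD]⟩, h⟩
  choose P B D h using hs
  refine Nat.card_congr (Equiv.ofBijective (fun x => (P x.1 * (blockUnit x.2.1 x.2.2)⁻¹,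
    ⟨x.2.1.val * (B x.1).val * x.2.1⁻¹.val, ?_⟩, ⟨x.2.2.val * (D x.1).val * x.2.2⁻¹.val, ?_⟩))
    ⟨?_, ?_⟩)
  · rw [Matrix.coe_units_inv, charpoly_units_conj]; exact (B x.1).2
  · rw [Matrix.coe_units_inv, charpoly_units_conj]; exact (D x.1).2
  · rintro ⟨A, a, d⟩ ⟨A', a', d'⟩ hx
    simp only [Prod.mk.injEq, Subtype.mk.injEq] at hx
    obtain ⟨h1, h2, h3⟩ := hx
    have h4 : fromBlocks (a.val * (B A).val * a⁻¹.val) 0 0 (d.val * (D A).val * d⁻¹.val) =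
      fromBlocks (a'.val * (B A').val * a'⁻¹.val) 0 0 (d'.val * (D A').val * d'⁻¹.val) := by
      rw [h2, h3]
    have hrec : ∀ (A) (a : (Matrix (Fin k) (Fin k) K)ˣ) (d : (Matrix (Fin m) (Fin m) K)ˣ),
      (P A * (blockUnit a d)⁻¹).val *
        fromBlocks (a.val * (B A).val * a⁻¹.val) 0 0 (d.val * (D A).val * d⁻¹.val) *
        (P A * (blockUnit a d)⁻¹)⁻¹.val = A.val := by
      intro A a d
      rw [blockUnit_conj, ← h A]
      simp only [_root_.mul_inv_rev, inv_inv, Units.val_mul, mul_assoc, Units.inv_mul_cancel_left]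
    have hA : A = A' := Subtype.ext (by rw [← hrec A a d, ← hrec A' a' d', h1, h4])
    subst hA
    obtain ⟨rfl, rfl⟩ := blockUnit_inj (inv_injective (mul_left_cancel h1))
    rfl
  · rintro ⟨Q, B', D'⟩
    let A : {A : Matrix (Fin k ⊕ Fin m) (Fin k ⊕ Fin m) K //
        ∃ g, G g ∧ A.charpoly = (X - C μ) ^ k * g} :=
      ⟨Q.val * fromBlocks B'.val 0 0 D'.val * Q⁻¹.val, D'.val.charpoly, D'.2, by
        rw [Matrix.coe_units_inv, charpoly_units_conj, charpoly_fromBlocks_zero₁₂, B'.2]⟩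
    have hA : Q.val * fromBlocks B'.val 0 0 D'.val * Q⁻¹.val = A.val := rfl
    rw [← h A] at hA
    have h1 : (Q⁻¹ * P A).val * fromBlocks (B A).val 0 0 (D A).val * (Q⁻¹ * P A)⁻¹.val =
        fromBlocks B'.val 0 0 D'.val := by
      simp only [_root_.mul_inv_rev, inv_inv, Units.val_mul]
      calc _ = Q⁻¹.val * ((P A).val * fromBlocks (B A).val 0 0 (D A).val * (P A)⁻¹.val) *
            Q.val := by simp only [mul_assoc]
        _ = _ := by
          rw [← hA]
          simp only [mul_assoc, Units.inv_mul, Units.inv_mul_cancel_left, mul_one]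
    obtain ⟨a, d, had⟩ := exists_eq_blockUnit (B A).2 B'.2 (hG _ (D A).2) (hG _ D'.2) h1
    rw [had, ← blockUnit_conj, fromBlocks_inj] at h1
    refine ⟨(A, a, d), ?_⟩
    simp only [Prod.mk.injEq]
    refine ⟨?_, Subtype.ext h1.1, Subtype.ext h1.2.2.2⟩
    rw [← had]
    group

/-- The number of matrices whose characteristic polynomial satisfies `G`, divided by the order of
the general linear group. -/
noncomputable def charpolyWeight (K : Type*) [Field K] (n : ℕ) (G : K[X] → Prop) : ℝ :=
  (Nat.card {A : Matrix (Fin n) (Fin n) K // G A.charpoly} : ℝ) /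
    (Nat.card (Matrix (Fin n) (Fin n) K)ˣ : ℝ)

theorem card_GL_ne_zero (K ι : Type*) [Field K] [Fintype K] [Fintype ι] [DecidableEq ι] :
    (Nat.card (Matrix ι ι K)ˣ : ℝ) ≠ 0 := by
  have : Finite (Matrix ι ι K)ˣ := inferInstance
  exact_mod_cast Nat.card_pos.ne'

theorem charpolyWeight_split {K : Type*} [Field K] [Fintype K] (μ : K) (k m : ℕ) (G : K[X] → Prop)
    (hG : ∀ g, G g → g.eval μ ≠ 0) :
    charpolyWeight K (k + m) (fun p => ∃ g, G g ∧ p = (X - C μ) ^ k * g) =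
      charpolyWeight K k (fun p => p = (X - C μ) ^ k) * charpolyWeight K m G := by
  have h := card_charpoly_split μ k m G hG
  have e1 : Nat.card (Matrix (Fin k ⊕ Fin m) (Fin k ⊕ Fin m) K)ˣ =
      Nat.card (Matrix (Fin (k + m)) (Fin (k + m)) K)ˣ :=
    Nat.card_congr (Units.mapEquiv (Matrix.reindexAlgEquiv K K finSumFinEquiv).toMulEquiv).toEquiv
  have e2 : Nat.card {A : Matrix (Fin k ⊕ Fin m) (Fin k ⊕ Fin m) K //
        ∃ g, G g ∧ A.charpoly = (X - C μ) ^ k * g} =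
      Nat.card {A : Matrix (Fin (k + m)) (Fin (k + m)) K //
        ∃ g, G g ∧ A.charpoly = (X - C μ) ^ k * g} :=
    Nat.card_congr ((Matrix.reindex finSumFinEquiv finSumFinEquiv).subtypeEquiv fun A => by
      rw [charpoly_reindex])
  rw [e1, e2] at h
  have h' := congrArg (Nat.cast : ℕ → ℝ) h
  push_cast at h'
  have h1 := card_GL_ne_zero K (Fin k)
  have h2 := card_GL_ne_zero K (Fin m)
  have h3 := card_GL_ne_zero K (Fin (k + m))
  unfold charpolyWeight
  field_simp
  linarith

/-- The proportion of nilpotent matrices relative to the order of the general linear group. -/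
noncomputable def nilpotentWeight (K : Type*) [Field K] (k : ℕ) : ℝ :=
  charpolyWeight K k (fun p => p = X ^ k)

theorem charpolyWeight_X_sub_C_pow {K : Type*} [Field K] (μ : K) (k : ℕ) :
    charpolyWeight K k (fun p => p = (X - C μ) ^ k) = nilpotentWeight K k := by
  unfold nilpotentWeight charpolyWeight
  congr 2
  refine Nat.card_congr ((Equiv.subRight (scalar (Fin k) μ)).subtypeEquiv fun A => ?_)
  rw [Equiv.subRight_apply, charpoly_sub_scalar]
  constructor
  · intro h; simp [h]
  · intro h
    have h2 := congrArg (fun p => p.comp (X - C μ)) h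
    simpa [comp_assoc] using h2

/-- `p` has no root in `S`. -/
def NoRootIn {K : Type*} [Field K] (S : Finset K) (p : K[X]) : Prop := ∀ t ∈ S, p.eval t ≠ 0

theorem rootMultiplicity_eq_iff_exists {K : Type*} [Field K] [DecidableEq K] {S : Finset K} {μ : K}
    (hμ : μ ∉ S) {p : K[X]} (hp : p ≠ 0) (k : ℕ) :
    (NoRootIn S p ∧ p.rootMultiplicity μ = k) ↔
      ∃ g, NoRootIn (insert μ S) g ∧ p = (X - C μ) ^ k * g := by
  constructor
  · rintro ⟨h, rfl⟩
    obtain ⟨g, hg, hgn⟩ := exists_eq_pow_rootMultiplicity_mul_and_not_dvd p hp μ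
    refine ⟨g, fun t ht => ?_, hg⟩
    rw [Finset.mem_insert] at ht
    rcases ht with rfl | ht
    · rwa [dvd_iff_isRoot] at hgn
    · intro h0
      apply h t ht
      rw [hg, eval_mul, h0, mul_zero]
  · rintro ⟨g, hg, rfl⟩
    refine ⟨fun t ht => ?_, ?_⟩
    · rw [eval_mul, eval_pow]
      refine mul_ne_zero (pow_ne_zero _ ?_) (hg t (Finset.mem_insert_of_mem ht))
      rw [eval_sub, eval_X, eval_C, sub_ne_zero]
      rintro rfl
      exact hμ ht
    · rw [rootMultiplicity_mul hp, rootMultiplicity_X_sub_C_pow,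
        rootMultiplicity_eq_zero (hg μ (Finset.mem_insert_self _ _)), add_zero]

theorem charpolyWeight_noRootIn {K : Type*} [Field K] [Fintype K] [DecidableEq K] {S : Finset K}
    {μ : K} (hμ : μ ∉ S) (n : ℕ) :
    charpolyWeight K n (NoRootIn S) = ∑ x ∈ Finset.HasAntidiagonal.antidiagonal n,
      nilpotentWeight K x.1 * charpolyWeight K x.2 (NoRootIn (insert μ S)) := by
  classical
  have h1 : Nat.card {A : Matrix (Fin n) (Fin n) K // NoRootIn S A.charpoly} =
      ∑ k ∈ Finset.range (n + 1), Nat.card {A : Matrix (Fin n) (Fin n) K //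
        ∃ g, NoRootIn (insert μ S) g ∧ A.charpoly = (X - C μ) ^ k * g} := by
    simp only [Nat.card_eq_fintype_card, Fintype.card_subtype]
    rw [Finset.card_eq_sum_card_fiberwise (f := fun A => A.charpoly.rootMultiplicity μ)
      (t := Finset.range (n + 1))]
    · refine Finset.sum_congr rfl fun k _ => ?_
      congr 1
      ext A
      simp only [Finset.mem_filter, Finset.mem_univ, true_and]
      exact rootMultiplicity_eq_iff_exists hμ (charpoly_monic A).ne_zero k
    · intro A _
      simp only [Finset.coe_range, Set.mem_Iio]
      have h2 := (Multiset.count_le_card μ A.charpoly.roots).trans (card_roots' _)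
      rw [count_roots, charpoly_natDegree_eq_dim, Fintype.card_fin] at h2
      omega
  rw [Finset.Nat.sum_antidiagonal_eq_sum_range_succ
    (f := fun i j => nilpotentWeight K i * charpolyWeight K j (NoRootIn (insert μ S)))]
  rw [charpolyWeight, h1, Nat.cast_sum, Finset.sum_div]
  refine Finset.sum_congr rfl fun k hk => ?_
  obtain ⟨m, rfl⟩ := Nat.exists_eq_add_of_le (Nat.lt_succ_iff.1 (Finset.mem_range.1 hk))
  have h3 := charpolyWeight_split μ k m (NoRootIn (insert μ S))
    (fun g hg => hg μ (Finset.mem_insert_self _ _))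
  rw [charpolyWeight_X_sub_C_pow] at h3
  rw [Nat.add_sub_cancel_left, ← h3, charpolyWeight]

/-- The generating function of the matrices without eigenvalues in `S`. -/
noncomputable def noRootSeries {K : Type*} [Field K] (S : Finset K) : PowerSeries ℝ :=
  PowerSeries.mk fun n => charpolyWeight K n (NoRootIn S)

/-- The generating function of the nilpotent matrices. -/
noncomputable def nilpotentSeries (K : Type*) [Field K] : PowerSeries ℝ :=
  PowerSeries.mk (nilpotentWeight K)

theorem noRootSeries_eq_mul_insert {K : Type*} [Field K] [Fintype K] [DecidableEq K] {S : Finset K}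
    {μ : K} (hμ : μ ∉ S) :
    noRootSeries S = nilpotentSeries K * noRootSeries (insert μ S) := by
  ext n
  rw [PowerSeries.coeff_mul]
  simp only [noRootSeries, nilpotentSeries, PowerSeries.coeff_mk]
  exact charpolyWeight_noRootIn hμ n

theorem prod_Icc_one_eq_prod_range {M : Type*} [CommMonoid M] (f : ℕ → M) (n : ℕ) :
    ∏ i ∈ Finset.Icc 1 n, f i = ∏ i ∈ Finset.range n, f (i + 1) := by
  induction n with
  | zero => simp
  | succ n ih => rw [Finset.prod_Icc_succ_top (by omega), Finset.prod_range_succ, ih]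

theorem card_GL_eq (K : Type*) [Field K] [Fintype K] (n : ℕ) :
    (Nat.card (Matrix (Fin n) (Fin n) K)ˣ : ℝ) = (Fintype.card K : ℝ) ^ (n ^ 2) *
      ∏ i ∈ Finset.Icc 1 n, (1 - ((Fintype.card K : ℝ))⁻¹ ^ i) := by
  have h := Matrix.card_GL_field (𝔽 := K) n
  have hq : (Fintype.card K : ℝ) ≠ 0 := by exact_mod_cast Fintype.card_ne_zero
  change Nat.card (Matrix (Fin n) (Fin n) K)ˣ = _ at h
  rw [h, Fin.prod_univ_eq_prod_range (fun i => Fintype.card K ^ n - Fintype.card K ^ i),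
    prod_Icc_one_eq_prod_range, ← Finset.prod_range_reflect (fun i => 1 - _ ^ (i + 1)),
    Nat.cast_prod, sq, pow_mul]
  nth_rewrite 4 [← Finset.card_range n]
  rw [← Finset.prod_const, ← Finset.prod_mul_distrib]
  refine Finset.prod_congr rfl fun i hi => ?_
  have hi' := Finset.mem_range.1 hi
  rw [Nat.cast_sub (Nat.pow_le_pow_right Fintype.card_pos hi'.le)]
  obtain ⟨j, rfl⟩ := Nat.exists_eq_add_of_lt hi'
  have e : i + j + 1 - 1 - i + 1 = j + 1 := by omega
  rw [e]
  push_cast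
  rw [inv_pow]
  field_simp
  ring

theorem noRootSeries_singleton_zero (K : Type*) [Field K] [Fintype K] :
    noRootSeries ({0} : Finset K) = PowerSeries.mk 1 := by
  ext n
  simp only [noRootSeries, PowerSeries.coeff_mk, charpolyWeight, Pi.one_apply]
  rw [div_eq_one_iff_eq (card_GL_ne_zero K (Fin n))]
  congr 1
  refine (Nat.card_congr (Equiv.ofBijective (fun A : (Matrix (Fin n) (Fin n) K)ˣ =>
    (⟨A.val, ?_⟩ : {A : Matrix (Fin n) (Fin n) K // NoRootIn {0} A.charpoly})) ⟨?_, ?_⟩)).symm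
  · intro t ht
    rw [Finset.mem_singleton] at ht
    subst ht
    rw [Matrix.eval_charpoly, map_zero, zero_sub, Matrix.det_neg]
    refine mul_ne_zero (pow_ne_zero _ (by simp)) ?_
    exact ((Matrix.isUnit_iff_isUnit_det _).1 A.isUnit).ne_zero
  · intro A B h
    exact Units.ext (congrArg Subtype.val h)
  · rintro ⟨A, hA⟩
    have h0 := isUnit_scalar_sub (hA 0 (Finset.mem_singleton_self _))
    rw [map_zero, zero_sub, IsUnit.neg_iff] at h0
    exact ⟨h0.unit, rfl⟩

theorem noRootSeries_univ (K : Type*) [Field K] [Fintype K] :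
    noRootSeries (Finset.univ : Finset K) = PowerSeries.mk (vGL K) := by
  ext n
  simp only [noRootSeries, PowerSeries.coeff_mk, charpolyWeight, vGL]
  congr 2
  refine (Nat.card_congr (Equiv.ofBijective (fun A : {A : (Matrix (Fin n) (Fin n) K)ˣ //
      ∀ t : K, ((A.val : Matrix (Fin n) (Fin n) K).charpoly).eval t ≠ 0} =>
    (⟨A.1.val, fun t _ => A.2 t⟩ : {A : Matrix (Fin n) (Fin n) K //
      NoRootIn Finset.univ A.charpoly})) ⟨?_, ?_⟩)).symm
  · intro A B h
    exact Subtype.ext (Units.ext (congrArg Subtype.val h))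
  · rintro ⟨A, hA⟩
    have h0 := isUnit_scalar_sub (hA 0 (Finset.mem_univ _))
    rw [map_zero, zero_sub, IsUnit.neg_iff] at h0
    exact ⟨⟨h0.unit, fun t => hA t (Finset.mem_univ t)⟩, rfl⟩

theorem mk_one_eq_nilpotentSeries_pow_mul (K : Type*) [Field K] [Fintype K] :
    PowerSeries.mk 1 =
      nilpotentSeries K ^ (Fintype.card K - 1) * PowerSeries.mk (vGL K) := by
  classical
  have key : ∀ S : Finset K, 0 ∉ S → noRootSeries ({0} : Finset K) =
      nilpotentSeries K ^ S.card * noRootSeries (insert 0 S) := by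
    intro S
    induction S using Finset.induction_on with
    | empty => simp
    | insert a S ha ih =>
      intro h0
      rw [Finset.mem_insert, not_or] at h0
      have ha' : a ∉ insert 0 S := by
        rw [Finset.mem_insert, not_or]; exact ⟨fun h => h0.1 h.symm, ha⟩
      rw [ih h0.2, noRootSeries_eq_mul_insert ha', Finset.card_insert_of_notMem ha, pow_succ,
        mul_assoc, Finset.insert_comm]
  have h := key (Finset.univ.erase 0) (Finset.notMem_erase _ _)
  rwa [Finset.insert_erase (Finset.mem_univ _), Finset.card_erase_of_mem (Finset.mem_univ _),
    noRootSeries_univ, noRootSeries_singleton_zero, Finset.card_univ] at h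

theorem nilpotentSeries_eq (K : Type*) [Field K] [Fintype K] :
    nilpotentSeries K = (1 - PowerSeries.X) * PowerSeries.mk
      (fun n => (∏ i ∈ Finset.Icc 1 n, (1 - ((Fintype.card K : ℝ))⁻¹ ^ i))⁻¹) := by
  classical
  have h := noRootSeries_eq_mul_insert (K := K) (S := ∅) (μ := 0) (by simp)
  have h1 : noRootSeries (∅ : Finset K) = PowerSeries.mk
      (fun n => (∏ i ∈ Finset.Icc 1 n, (1 - ((Fintype.card K : ℝ))⁻¹ ^ i))⁻¹) := by
    ext n
    have hq : (Fintype.card K : ℝ) ≠ 0 := by exact_mod_cast Fintype.card_ne_zero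
    simp only [noRootSeries, PowerSeries.coeff_mk, charpolyWeight]
    have e : Nat.card {A : Matrix (Fin n) (Fin n) K // NoRootIn ∅ A.charpoly} =
        Fintype.card K ^ (n ^ 2) := by
      rw [Nat.card_congr (Equiv.subtypeUnivEquiv fun A => by simp [NoRootIn])]
      change Nat.card (Fin n → Fin n → K) = _
      rw [Nat.card_fun, Nat.card_fun, Nat.card_fin, Nat.card_eq_fintype_card, ← pow_mul, sq]
    rw [e, card_GL_eq, Nat.cast_pow, div_mul_eq_div_div, div_self (pow_ne_zero _ hq), one_div]
  rw [insert_empty_eq, noRootSeries_singleton_zero] at h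
  rw [← h1, h, mul_comm, mul_assoc, PowerSeries.mk_one_mul_one_sub_eq_one, mul_one]

/-- The coefficients of `∏ i ≥ 1, (1 - u / q ^ i)` as a power series in `u`. -/
noncomputable def eulerCoeff (q : ℝ) (k : ℕ) : ℝ := ∏ i ∈ Finset.range k, -(q ^ (i + 1) - 1)⁻¹

theorem eulerCoeff_succ {q : ℝ} (hq : 1 < q) (k : ℕ) :
    q ^ (k + 1) * eulerCoeff q (k + 1) = eulerCoeff q (k + 1) - eulerCoeff q k := by
  have h : q ^ (k + 1) - 1 ≠ 0 := (sub_pos.2 (one_lt_pow₀ hq k.succ_ne_zero)).ne'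
  rw [eulerCoeff, eulerCoeff, Finset.prod_range_succ]
  field_simp
  ring

theorem rescale_eulerSeries {q : ℝ} (hq : 1 < q) :
    PowerSeries.rescale q (PowerSeries.mk (eulerCoeff q)) =
      (1 - PowerSeries.X) * PowerSeries.mk (eulerCoeff q) := by
  ext n
  rw [PowerSeries.coeff_rescale, sub_mul, one_mul, map_sub]
  cases n with
  | zero => simp
  | succ n =>
    rw [PowerSeries.coeff_succ_X_mul]
    simp only [PowerSeries.coeff_mk]
    exact eulerCoeff_succ hq n

theorem one_sub_inv_pow_pos {q : ℝ} (hq : 1 < q) (i : ℕ) : 0 < 1 - q⁻¹ ^ (i + 1) :=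
  sub_pos.2 (pow_lt_one₀ (by positivity) (inv_lt_one_of_one_lt₀ hq) i.succ_ne_zero)

theorem prod_one_sub_inv_pow_pos {q : ℝ} (hq : 1 < q) (n : ℕ) :
    0 < ∏ i ∈ Finset.Icc 1 n, (1 - q⁻¹ ^ i) := by
  rw [prod_Icc_one_eq_prod_range]
  exact Finset.prod_pos fun i _ => one_sub_inv_pow_pos hq i

theorem nilpotentWeight_eq (K : Type*) [Field K] [Fintype K] (n : ℕ) :
    nilpotentWeight K n = ((Fintype.card K : ℝ)⁻¹) ^ n *
      (∏ i ∈ Finset.Icc 1 n, (1 - ((Fintype.card K : ℝ))⁻¹ ^ i))⁻¹ := by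
  have hq : (1 : ℝ) < Fintype.card K := by exact_mod_cast Fintype.one_lt_card
  have h := congrArg (PowerSeries.coeff n) (nilpotentSeries_eq K)
  rw [sub_mul, one_mul, map_sub] at h
  simp only [nilpotentSeries, PowerSeries.coeff_mk] at h
  rw [h]
  cases n with
  | zero => simp
  | succ n =>
    rw [PowerSeries.coeff_succ_X_mul, PowerSeries.coeff_mk, Finset.prod_Icc_succ_top (by omega)]
    have h1 := (prod_one_sub_inv_pow_pos hq n).ne'
    have h2 := (one_sub_inv_pow_pos hq n).ne'
    generalize ∏ i ∈ Finset.Icc 1 n, (1 - ((Fintype.card K : ℝ))⁻¹ ^ i) = c at *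
    generalize ((Fintype.card K : ℝ))⁻¹ ^ (n + 1) = x at *
    field_simp
    ring

theorem rescale_nilpotentSeries (K : Type*) [Field K] [Fintype K] :
    (1 - PowerSeries.X) * PowerSeries.rescale (Fintype.card K : ℝ) (nilpotentSeries K) =
      nilpotentSeries K := by
  conv_rhs => rw [nilpotentSeries_eq]
  congr 1
  ext n
  have hq : (Fintype.card K : ℝ) ≠ 0 := by exact_mod_cast Fintype.card_ne_zero
  rw [PowerSeries.coeff_rescale, nilpotentSeries, PowerSeries.coeff_mk, PowerSeries.coeff_mk,
    nilpotentWeight_eq, ← mul_assoc, ← mul_pow, mul_inv_cancel₀ hq, one_pow, one_mul]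

theorem eulerSeries_mul_nilpotentSeries (K : Type*) [Field K] [Fintype K] :
    PowerSeries.mk (eulerCoeff (Fintype.card K)) * nilpotentSeries K = 1 := by
  have hq : (1 : ℝ) < Fintype.card K := by exact_mod_cast Fintype.one_lt_card
  have h : PowerSeries.rescale (Fintype.card K : ℝ)
      (PowerSeries.mk (eulerCoeff (Fintype.card K)) * nilpotentSeries K) =
      PowerSeries.mk (eulerCoeff (Fintype.card K)) * nilpotentSeries K := by
    rw [map_mul, rescale_eulerSeries hq]
    conv_rhs => rw [← rescale_nilpotentSeries K]
    ring
  ext n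
  cases n with
  | zero =>
    simp [nilpotentSeries, nilpotentWeight_eq, eulerCoeff, PowerSeries.coeff_zero_eq_constantCoeff]
  | succ n =>
    have h1 := congrArg (PowerSeries.coeff (n + 1)) h
    rw [PowerSeries.coeff_rescale] at h1
    rw [PowerSeries.coeff_one, if_neg n.succ_ne_zero]
    have h2 : (1 : ℝ) < (Fintype.card K : ℝ) ^ (n + 1) := one_lt_pow₀ hq n.succ_ne_zero
    by_contra h0
    have h3 := mul_right_cancel₀ h0 (h1.trans (one_mul _).symm)
    linarith

theorem vGL_eq_sum (K : Type*) [Field K] [Fintype K] (n : ℕ) :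
    vGL K n = ∑ k ∈ Finset.range (n + 1), PowerSeries.coeff k
      (PowerSeries.mk (eulerCoeff (Fintype.card K)) ^ (Fintype.card K - 1)) := by
  have h : PowerSeries.mk (vGL K) =
      PowerSeries.mk (eulerCoeff (Fintype.card K)) ^ (Fintype.card K - 1) * PowerSeries.mk 1 := by
    rw [mk_one_eq_nilpotentSeries_pow_mul K, ← mul_assoc, ← mul_pow,
      eulerSeries_mul_nilpotentSeries, one_pow, one_mul]
  have h1 := congrArg (PowerSeries.coeff n) h
  rw [PowerSeries.coeff_mk, PowerSeries.coeff_mul] at h1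
  rw [h1, Finset.Nat.sum_antidiagonal_eq_sum_range_succ_mk]
  simp

theorem alphaStar_eq (K : Type*) [Field K] [Fintype K] (m : ℕ) :
    alphaStar K (Fintype.card K) (m + 1) =
      vGL K m * ∏ i ∈ Finset.Icc 1 (m + 1), (1 - ((Fintype.card K : ℝ))⁻¹ ^ i) := by
  classical
  have hq : (1 : ℝ) < Fintype.card K := by exact_mod_cast Fintype.one_lt_card
  have h1 : Nat.card {A : Matrix (Fin (1 + m)) (Fin (1 + m)) K //
      ∃ (lam : K) (f₀ : Polynomial K), lam ≠ 0 ∧ f₀.Monic ∧ f₀.natDegree = 1 + m - 1 ∧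
        (∀ t : K, f₀.eval t ≠ 0) ∧ A.charpoly = f₀ * (X - C lam)} =
      ∑ lam ∈ Finset.univ.erase (0 : K), Nat.card {A : Matrix (Fin (1 + m)) (Fin (1 + m)) K //
        ∃ g, NoRootIn Finset.univ g ∧ A.charpoly = (X - C lam) ^ 1 * g} := by
    simp only [Nat.card_eq_fintype_card, Fintype.card_subtype]
    rw [← Finset.card_biUnion]
    · congr 1
      ext A
      simp only [Finset.mem_filter, Finset.mem_univ, true_and, Finset.mem_biUnion,
        Finset.mem_erase, and_true]
      constructor
      · rintro ⟨lam, f, h0, -, -, hf, hA⟩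
        exact ⟨lam, h0, f, fun t _ => hf t, by rw [hA, pow_one, mul_comm]⟩
      · rintro ⟨lam, h0, f, hf, hA⟩
        rw [pow_one, mul_comm] at hA
        have hm : f.Monic := (monic_X_sub_C lam).of_mul_monic_right (hA ▸ charpoly_monic A)
        refine ⟨lam, f, h0, hm, ?_, fun t => hf t (Finset.mem_univ t), hA⟩
        have hd := congrArg natDegree hA
        rw [charpoly_natDegree_eq_dim, hm.natDegree_mul (monic_X_sub_C lam), natDegree_X_sub_C,
          Fintype.card_fin] at hd
        omega
    · intro a _ b _ hab
      rw [Function.onFun, Finset.disjoint_left]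
      intro A hA hB
      simp only [Finset.mem_filter, Finset.mem_univ, true_and] at hA hB
      obtain ⟨f, hf, hA⟩ := hA
      obtain ⟨g, hg, hB⟩ := hB
      have h2 : A.charpoly.eval a = 0 := by simp [hA]
      rw [hB, eval_mul, pow_one, eval_sub, eval_X, eval_C, mul_eq_zero] at h2
      exact h2.elim (fun h => hab (sub_eq_zero.1 h)) (hg a (Finset.mem_univ a))
  have h2 : ∀ lam : K, charpolyWeight K (1 + m)
      (fun p => ∃ g, NoRootIn Finset.univ g ∧ p = (X - C lam) ^ 1 * g) =
        ((Fintype.card K : ℝ) - 1)⁻¹ * vGL K m := by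
    intro lam
    rw [charpolyWeight_split lam 1 m _ (fun g hg => hg lam (Finset.mem_univ _)),
      charpolyWeight_X_sub_C_pow, nilpotentWeight_eq]
    have h3 := congrArg (PowerSeries.coeff m) (noRootSeries_univ K)
    simp only [noRootSeries, PowerSeries.coeff_mk] at h3
    rw [h3]
    congr 1
    have : (Fintype.card K : ℝ) - 1 ≠ 0 := by linarith
    simp
    field_simp
  have h4 : (Nat.card {A : Matrix (Fin (1 + m)) (Fin (1 + m)) K //
      ∃ (lam : K) (f₀ : Polynomial K), lam ≠ 0 ∧ f₀.Monic ∧ f₀.natDegree = 1 + m - 1 ∧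
        (∀ t : K, f₀.eval t ≠ 0) ∧ A.charpoly = f₀ * (X - C lam)} : ℝ) =
      vGL K m * Nat.card (Matrix (Fin (1 + m)) (Fin (1 + m)) K)ˣ := by
    rw [← div_eq_iff (card_GL_ne_zero K _), h1, Nat.cast_sum, Finset.sum_div]
    have h5 : ∀ lam ∈ Finset.univ.erase (0 : K),
        (Nat.card {A : Matrix (Fin (1 + m)) (Fin (1 + m)) K //
        ∃ g, NoRootIn Finset.univ g ∧ A.charpoly = (X - C lam) ^ 1 * g} : ℝ) /
        Nat.card (Matrix (Fin (1 + m)) (Fin (1 + m)) K)ˣ =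
        ((Fintype.card K : ℝ) - 1)⁻¹ * vGL K m := fun lam _ => h2 lam
    rw [Finset.sum_congr rfl h5, Finset.sum_const, Finset.card_erase_of_mem (Finset.mem_univ _),
      Finset.card_univ, nsmul_eq_mul, Nat.cast_sub Fintype.card_pos, Nat.cast_one, ← mul_assoc,
      mul_inv_cancel₀ (by linarith), one_mul]
  rw [Nat.add_comm m 1, alphaStar, h4, card_GL_eq]
  have : (Fintype.card K : ℝ) ≠ 0 := by linarith
  field_simp

theorem vGL_nonneg (K : Type*) [Field K] [Fintype K] (n : ℕ) : 0 ≤ vGL K n := by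
  unfold vGL; positivity

theorem vGL_le_one (K : Type*) [Field K] [Fintype K] (n : ℕ) : vGL K n ≤ 1 := by
  refine div_le_one_of_le₀ ?_ (Nat.cast_nonneg _)
  have : Finite (Matrix (Fin n) (Fin n) K)ˣ := inferInstance
  exact_mod_cast Finite.card_subtype_le _

theorem summable_abs_coeff_mul {p r : PowerSeries ℝ}
    (hp : Summable fun k => |PowerSeries.coeff k p|)
    (hr : Summable fun k => |PowerSeries.coeff k r|) :
    Summable (fun k => |PowerSeries.coeff k (p * r)|) ∧
      ∑' k, PowerSeries.coeff k (p * r) =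
        (∑' k, PowerSeries.coeff k p) * ∑' k, PowerSeries.coeff k r ∧
      ∑' k, |PowerSeries.coeff k (p * r)| ≤
        (∑' k, |PowerSeries.coeff k p|) * ∑' k, |PowerSeries.coeff k r| := by
  have hpn : Summable fun k => ‖PowerSeries.coeff k p‖ := hp
  have hrn : Summable fun k => ‖PowerSeries.coeff k r‖ := hr
  have hpa : Summable fun k => ‖|PowerSeries.coeff k p|‖ := by
    simpa only [Real.norm_eq_abs, abs_abs] using hp
  have hra : Summable fun k => ‖|PowerSeries.coeff k r|‖ := by
    simpa only [Real.norm_eq_abs, abs_abs] using hr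
  have ha : Summable fun k => |PowerSeries.coeff k (p * r)| := by
    have := summable_norm_sum_mul_antidiagonal_of_summable_norm hpn hrn
    simpa only [Real.norm_eq_abs, ← PowerSeries.coeff_mul] using this
  refine ⟨ha, ?_, ?_⟩
  · rw [tsum_mul_tsum_eq_tsum_sum_antidiagonal_of_summable_norm hpn hrn]
    simp only [PowerSeries.coeff_mul]
  · rw [tsum_mul_tsum_eq_tsum_sum_antidiagonal_of_summable_norm hpa hra]
    refine ha.tsum_le_tsum (fun n => ?_)
      (summable_norm_sum_mul_antidiagonal_of_summable_norm hpa hra).of_norm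
    rw [PowerSeries.coeff_mul]
    refine (Finset.abs_sum_le_sum_abs _ _).trans (le_of_eq ?_)
    exact Finset.sum_congr rfl fun x _ => abs_mul _ _

theorem summable_abs_coeff_pow {p : PowerSeries ℝ} (hp : Summable fun k => |PowerSeries.coeff k p|)
    (j : ℕ) : Summable (fun k => |PowerSeries.coeff k (p ^ j)|) ∧
      ∑' k, PowerSeries.coeff k (p ^ j) = (∑' k, PowerSeries.coeff k p) ^ j ∧
      ∑' k, |PowerSeries.coeff k (p ^ j)| ≤ (∑' k, |PowerSeries.coeff k p|) ^ j := by
  induction j with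
  | zero =>
    have h0 : ∀ k ≠ 0, PowerSeries.coeff k (1 : PowerSeries ℝ) = 0 := fun k hk => by
      rw [PowerSeries.coeff_one, if_neg hk]
    have h1 : ∀ k ≠ 0, |PowerSeries.coeff k (1 : PowerSeries ℝ)| = 0 := fun k hk => by
      rw [h0 k hk, abs_zero]
    simp only [pow_zero]
    rw [tsum_eq_single 0 h0, tsum_eq_single 0 h1]
    refine ⟨summable_of_ne_finset_zero (s := {0}) fun k hk => h1 k (by simpa using hk), ?_, ?_⟩ <;>
    simp
  | succ j ih =>
    obtain ⟨h1, h2, h3⟩ := ih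
    rw [pow_succ]
    obtain ⟨h4, h5, h6⟩ := summable_abs_coeff_mul h1 hp
    refine ⟨h4, by rw [h5, h2, pow_succ], h6.trans ?_⟩
    rw [pow_succ]
    exact mul_le_mul_of_nonneg_right h3 (tsum_nonneg fun _ => abs_nonneg _)

theorem abs_eulerCoeff_succ {q : ℝ} (hq : 1 < q) (k : ℕ) :
    |eulerCoeff q (k + 1)| = |eulerCoeff q k| * (q ^ (k + 1) - 1)⁻¹ := by
  have h : 0 < q ^ (k + 1) - 1 := sub_pos.2 (one_lt_pow₀ hq k.succ_ne_zero)
  rw [eulerCoeff, eulerCoeff, Finset.prod_range_succ, abs_mul, abs_neg, abs_inv, abs_of_pos h]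

theorem abs_eulerCoeff_mul_sq_pow_le {q : ℝ} (hq : 2 ≤ q) (k : ℕ) :
    |eulerCoeff q k| * (q ^ 2) ^ k ≤ 16 * q * (1 / 2) ^ k := by
  have hstep : ∀ (k : ℕ) (r C : ℝ), |eulerCoeff q k| * (q ^ 2) ^ k ≤ C → 0 ≤ r →
      q ^ 2 ≤ r * (q ^ (k + 1) - 1) →
      |eulerCoeff q (k + 1)| * (q ^ 2) ^ (k + 1) ≤ C * r := by
    intro k r C h hr h2
    have h3 : 0 < q ^ (k + 1) - 1 := sub_pos.2 (one_lt_pow₀ (by linarith) k.succ_ne_zero)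
    rw [abs_eulerCoeff_succ (by linarith), pow_succ (q ^ 2) k]
    calc _ = (|eulerCoeff q k| * (q ^ 2) ^ k) * (q ^ 2 / (q ^ (k + 1) - 1)) := by
          rw [div_eq_mul_inv]; ring
      _ ≤ C * r := by
        refine mul_le_mul h ((div_le_iff₀ h3).2 h2) (by positivity) ?_
        exact le_trans (by positivity) h
  have h0 : |eulerCoeff q 0| * (q ^ 2) ^ 0 ≤ 1 := by simp [eulerCoeff]
  have h1 := hstep 0 (2 * q) 1 h0 (by positivity) (by rw [zero_add, pow_one]; nlinarith)
  have h2 := hstep 1 (4 / 3) _ h1 (by norm_num) (by norm_num; nlinarith)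
  have h3 := hstep 2 (4 / 7) _ h2 (by norm_num)
    (by norm_num; nlinarith [mul_nonneg (sq_nonneg q) (sub_nonneg.2 hq)])
  obtain _ | _ | _ | k := k
  · linarith
  · norm_num at h1 ⊢; linarith
  · norm_num at h2 ⊢; linarith
  · induction k with
    | zero => norm_num at h3 ⊢; linarith
    | succ k ih =>
      have h4 := hstep _ (1 / 2) _ ih (by norm_num) (by
        have : q ^ 4 ≤ q ^ (k + 1 + 1 + 1 + 1) := pow_le_pow_right₀ (by linarith) (by omega)
        nlinarith [mul_nonneg (sq_nonneg q) (sub_nonneg.2 hq), sq_nonneg (q ^ 2)])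
      calc _ ≤ _ := h4
        _ = _ := by ring

theorem summable_eulerCoeff_mul_sq_pow {q : ℝ} (hq : 2 ≤ q) :
    Summable (fun k => |eulerCoeff q k| * (q ^ 2) ^ k) ∧
      ∑' k, |eulerCoeff q k| * (q ^ 2) ^ k ≤ q ^ 6 := by
  have hg : Summable fun k : ℕ => 16 * q * (1 / 2 : ℝ) ^ k := summable_geometric_two.mul_left _
  have hs : Summable (fun k => |eulerCoeff q k| * (q ^ 2) ^ k) :=
    hg.of_nonneg_of_le (fun k => by positivity) (abs_eulerCoeff_mul_sq_pow_le hq)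
  refine ⟨hs, (hs.tsum_le_tsum (abs_eulerCoeff_mul_sq_pow_le hq) hg).trans ?_⟩
  rw [tsum_mul_left, tsum_geometric_two]
  have : (2 : ℝ) ^ 5 ≤ q ^ 5 := pow_le_pow_left₀ (by norm_num) hq 5
  nlinarith

theorem summable_abs_eulerCoeff {q : ℝ} (hq : 2 ≤ q) : Summable fun k => |eulerCoeff q k| := by
  refine (summable_eulerCoeff_mul_sq_pow hq).1.of_nonneg_of_le (fun k => abs_nonneg _) fun k => ?_
  exact le_mul_of_one_le_right (abs_nonneg _) (one_le_pow₀ (one_le_pow₀ (by linarith)))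

theorem tsum_eulerCoeff_mul_inv_pow {q : ℝ} (hq : 2 ≤ q) (n : ℕ) :
    ∑' k, eulerCoeff q k =
      (∏ i ∈ Finset.Icc 1 n, (1 - q⁻¹ ^ i)) * ∑' k, eulerCoeff q k * (q⁻¹ ^ n) ^ k := by
  have hs : ∀ n : ℕ, Summable fun k => eulerCoeff q k * (q⁻¹ ^ n) ^ k := by
    intro n
    refine Summable.of_abs ((summable_abs_eulerCoeff hq).of_nonneg_of_le (fun k => abs_nonneg _)
      fun k => ?_)
    rw [abs_mul, abs_pow, abs_pow]
    refine mul_le_of_le_one_right (abs_nonneg _) (pow_le_one₀ (by positivity)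
      (pow_le_one₀ (by positivity) ?_))
    rw [abs_of_pos (by positivity)]
    exact inv_le_one_of_one_le₀ (by linarith)
  induction n with
  | zero => simp
  | succ n ih =>
    rw [Finset.prod_Icc_succ_top (by omega), ih, mul_assoc]
    congr 1
    have h1 := (hs n).tsum_eq_zero_add
    have h2 := (hs (n + 1)).tsum_eq_zero_add
    rw [h1]
    have h3 : ∀ k, eulerCoeff q (k + 1) * (q⁻¹ ^ n) ^ (k + 1) =
        eulerCoeff q (k + 1) * (q⁻¹ ^ (n + 1)) ^ (k + 1) -
          q⁻¹ ^ (n + 1) * (eulerCoeff q k * (q⁻¹ ^ (n + 1)) ^ k) := by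
      intro k
      have h4 : q⁻¹ ^ n = q * q⁻¹ ^ (n + 1) := by
        rw [pow_succ]; field_simp
      rw [h4, mul_pow, ← mul_assoc, mul_comm (eulerCoeff q (k + 1)) (q ^ (k + 1)),
        eulerCoeff_succ (by linarith)]
      ring
    rw [tsum_congr h3, Summable.tsum_sub ((summable_nat_add_iff 1).2 (hs (n + 1)))
      ((hs (n + 1)).mul_left _), tsum_mul_left, sub_mul, one_mul]
    conv_rhs => enter [1]; rw [h2]
    ring

theorem tsum_eulerCoeff {q c : ℝ} (hq : 2 ≤ q)
    (hc : Tendsto (fun n : ℕ => ∏ i ∈ Finset.Icc 1 n, (1 - q⁻¹ ^ i)) atTop (nhds c)) :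
    ∑' k, eulerCoeff q k = c := by
  have h1 : Tendsto (fun n : ℕ => ∑' k, eulerCoeff q k * (q⁻¹ ^ n) ^ k) atTop
      (nhds (∑' k : ℕ, if k = 0 then (1 : ℝ) else 0)) := by
    refine tendsto_tsum_of_dominated_convergence (summable_abs_eulerCoeff hq) (fun k => ?_)
      (Eventually.of_forall fun n k => ?_)
    · cases k with
      | zero => simp [eulerCoeff]
      | succ k =>
        simp only [Nat.succ_ne_zero, if_false]
        rw [← mul_zero (eulerCoeff q (k + 1))]
        refine Tendsto.const_mul _ ?_
        have := (tendsto_pow_atTop_nhds_zero_of_lt_one (r := q⁻¹) (by positivity)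
          (inv_lt_one_of_one_lt₀ (by linarith))).pow (k + 1)
        simpa using this
    · rw [Real.norm_eq_abs, abs_mul, abs_pow, abs_pow]
      refine mul_le_of_le_one_right (abs_nonneg _) (pow_le_one₀ (by positivity)
        (pow_le_one₀ (by positivity) ?_))
      rw [abs_of_pos (by positivity)]
      exact inv_le_one_of_one_le₀ (by linarith)
  rw [tsum_ite_eq] at h1
  have h2 := hc.mul h1
  simp only [← tsum_eulerCoeff_mul_inv_pow hq, mul_one] at h2
  exact tendsto_nhds_unique tendsto_const_nhds h2

theorem abs_tsum_pow_sub_sum_le {p : PowerSeries ℝ} {r : ℝ} (hr : 1 ≤ r)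
    (hp : Summable fun k => |PowerSeries.coeff k p| * r ^ k) (j n : ℕ) :
    |(∑' k, PowerSeries.coeff k p) ^ j - ∑ k ∈ Finset.range n, PowerSeries.coeff k (p ^ j)| ≤
      (r⁻¹) ^ n * (∑' k, |PowerSeries.coeff k p| * r ^ k) ^ j := by
  have hr0 : 0 < r := by linarith
  have hresc : ∀ (s : PowerSeries ℝ) (k : ℕ), |PowerSeries.coeff k (PowerSeries.rescale r s)| =
      |PowerSeries.coeff k s| * r ^ k := fun s k => by
    rw [PowerSeries.coeff_rescale, abs_mul, abs_of_pos (pow_pos hr0 k), mul_comm]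
  have hp0 : Summable fun k => |PowerSeries.coeff k p| :=
    hp.of_nonneg_of_le (fun k => abs_nonneg _) fun k =>
      le_mul_of_one_le_right (abs_nonneg _) (one_le_pow₀ hr)
  obtain ⟨h1, h2, -⟩ := summable_abs_coeff_pow hp0 j
  obtain ⟨h3, -, h4⟩ := summable_abs_coeff_pow (p := PowerSeries.rescale r p)
    (by simpa only [hresc] using hp) j
  rw [← map_pow] at h3 h4
  simp only [hresc] at h3 h4
  have h1' := (summable_nat_add_iff n).2 h1
  have h3' := (summable_nat_add_iff n).2 h3
  rw [← h2, ← h1.of_abs.sum_add_tsum_nat_add n, add_sub_cancel_left]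
  have h5 := norm_tsum_le_tsum_norm (f := fun k => PowerSeries.coeff (k + n) (p ^ j))
    (by simpa only [Real.norm_eq_abs] using h1')
  simp only [Real.norm_eq_abs] at h5
  have h6 : ∑' k, |PowerSeries.coeff (k + n) (p ^ j)| ≤
      ∑' k, r⁻¹ ^ n * (|PowerSeries.coeff (k + n) (p ^ j)| * r ^ (k + n)) := by
    refine h1'.tsum_le_tsum (fun k => ?_) (h3'.mul_left _)
    have h7 : r⁻¹ ^ n * (|PowerSeries.coeff (k + n) (p ^ j)| * r ^ (k + n)) =
        |PowerSeries.coeff (k + n) (p ^ j)| * r ^ k := by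
      rw [inv_pow, pow_add]; field_simp
    rw [h7]
    exact le_mul_of_one_le_right (abs_nonneg _) (one_le_pow₀ hr)
  rw [tsum_mul_left] at h6
  refine h5.trans (h6.trans (mul_le_mul_of_nonneg_left (le_trans ?_ h4) (by positivity)))
  rw [← h3.sum_add_tsum_nat_add n]
  exact le_add_of_nonneg_left (Finset.sum_nonneg fun k _ => by positivity)

theorem abs_sub_vGL_le (K : Type*) [Field K] [Fintype K] {c : ℝ}
    (hc : Tendsto (fun n : ℕ => ∏ i ∈ Finset.Icc 1 n, (1 - ((Fintype.card K : ℝ))⁻¹ ^ i)) atTop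
      (nhds c)) (n : ℕ) :
    |c ^ (Fintype.card K - 1) - vGL K n| ≤
      (Fintype.card K : ℝ) ^ (6 * (Fintype.card K - 1)) *
        (((Fintype.card K : ℝ))⁻¹ ^ 2) ^ (n + 1) := by
  have hq : (2 : ℝ) ≤ Fintype.card K := by exact_mod_cast Fintype.one_lt_card (α := K)
  obtain ⟨hs, hle⟩ := summable_eulerCoeff_mul_sq_pow hq
  have h := abs_tsum_pow_sub_sum_le (p := PowerSeries.mk (eulerCoeff (Fintype.card K)))
    (r := (Fintype.card K : ℝ) ^ 2) (one_le_pow₀ (by linarith))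
    (by simpa only [PowerSeries.coeff_mk] using hs) (Fintype.card K - 1) (n + 1)
  rw [← vGL_eq_sum] at h
  simp only [PowerSeries.coeff_mk] at h
  rw [tsum_eulerCoeff hq hc] at h
  refine h.trans ?_
  rw [mul_comm, pow_mul, inv_pow _ 2]
  refine mul_le_mul_of_nonneg_right (pow_le_pow_left₀ ?_ hle _) (by positivity)
  exact tsum_nonneg fun k => by positivity

theorem prod_Icc_lower_bound {q : ℝ} (hq : 2 ≤ q) (m k : ℕ) :
    (∏ i ∈ Finset.Icc 1 m, (1 - q⁻¹ ^ i)) * (1 - q⁻¹ ^ m / (q - 1) + q⁻¹ ^ (m + k) / (q - 1)) ≤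
      ∏ i ∈ Finset.Icc 1 (m + k), (1 - q⁻¹ ^ i) := by
  have hP : 0 < ∏ i ∈ Finset.Icc 1 m, (1 - q⁻¹ ^ i) := by
    exact prod_one_sub_inv_pow_pos (by linarith) m
  have hq1 : 0 < q - 1 := by linarith
  induction k with
  | zero => simp
  | succ k ih =>
    rw [← add_assoc, Finset.prod_Icc_succ_top (by omega)]
    have hx : 0 < q⁻¹ ^ (m + k + 1) := by positivity
    have hy : q⁻¹ ^ (m + k) = q * q⁻¹ ^ (m + k + 1) := by
      rw [pow_succ]; field_simp
    have h1 : 0 < 1 - q⁻¹ ^ (m + k + 1) := one_sub_inv_pow_pos (by linarith) (m + k)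
    refine le_trans ?_ (mul_le_mul_of_nonneg_right ih h1.le)
    rw [mul_assoc]
    refine mul_le_mul_of_nonneg_left ?_ hP.le
    have hmono : q⁻¹ ^ (m + k) ≤ q⁻¹ ^ m :=
      pow_le_pow_of_le_one (by positivity) (inv_le_one_of_one_le₀ (by linarith)) (by omega)
    have h2 : q⁻¹ ^ (m + k) / (q - 1) ≤ q⁻¹ ^ m / (q - 1) :=
      div_le_div_of_nonneg_right hmono hq1.le
    have h3 : q⁻¹ ^ (m + k) / (q - 1) =
        q⁻¹ ^ (m + k + 1) / (q - 1) + q⁻¹ ^ (m + k + 1) := by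
      rw [hy]; field_simp; ring
    nlinarith [mul_nonneg hx.le (sub_nonneg.2 h2)]

theorem prod_Icc_mul_le_limit {q c : ℝ} (hq : 2 ≤ q)
    (hc : Tendsto (fun n : ℕ => ∏ i ∈ Finset.Icc 1 n, (1 - q⁻¹ ^ i)) atTop (nhds c)) (m : ℕ) :
    (∏ i ∈ Finset.Icc 1 m, (1 - q⁻¹ ^ i)) * (1 - q⁻¹ ^ m / (q - 1)) ≤ c := by
  refine ge_of_tendsto hc (eventually_atTop.2 ⟨m, fun n hn => ?_⟩)
  obtain ⟨k, rfl⟩ := Nat.exists_eq_add_of_le hn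
  refine le_trans (mul_le_mul_of_nonneg_left ?_ ?_) (prod_Icc_lower_bound hq m k)
  · have : 0 < q - 1 := by linarith
    exact le_add_of_nonneg_right (by positivity)
  · exact (prod_one_sub_inv_pow_pos (by linarith) m).le

theorem limit_le_prod_Icc {q c : ℝ} (hq : 2 ≤ q)
    (hc : Tendsto (fun n : ℕ => ∏ i ∈ Finset.Icc 1 n, (1 - q⁻¹ ^ i)) atTop (nhds c)) (m : ℕ) :
    c ≤ ∏ i ∈ Finset.Icc 1 m, (1 - q⁻¹ ^ i) := by
  refine Antitone.le_of_tendsto (antitone_nat_of_succ_le fun n => ?_) hc m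
  rw [Finset.prod_Icc_succ_top (by omega)]
  refine mul_le_of_le_one_right ?_ (sub_le_self _ (by positivity))
  exact (prod_one_sub_inv_pow_pos (by linarith) n).le

theorem limit_nonneg {q c : ℝ} (hq : 2 ≤ q)
    (hc : Tendsto (fun n : ℕ => ∏ i ∈ Finset.Icc 1 n, (1 - q⁻¹ ^ i)) atTop (nhds c)) :
    0 ≤ c := by
  refine ge_of_tendsto' hc fun n => ?_
  exact (prod_one_sub_inv_pow_pos (by linarith) n).le

theorem abs_limit_sub_prod_Icc_le {q c : ℝ} (hq : 2 ≤ q)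
    (hc : Tendsto (fun n : ℕ => ∏ i ∈ Finset.Icc 1 n, (1 - q⁻¹ ^ i)) atTop (nhds c)) (m : ℕ) :
    |c - ∏ i ∈ Finset.Icc 1 m, (1 - q⁻¹ ^ i)| ≤ q⁻¹ ^ m := by
  have hq1 : 0 < q - 1 := by linarith
  have h1 := limit_le_prod_Icc hq hc m
  have h2 := prod_Icc_mul_le_limit hq hc m
  have hP1 : ∏ i ∈ Finset.Icc 1 m, (1 - q⁻¹ ^ i) ≤ 1 := by
    refine Finset.prod_le_one (fun i hi => ?_) fun i _ => sub_le_self _ (by positivity)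
    exact sub_nonneg.2 (pow_le_one₀ (by positivity) (inv_le_one_of_one_le₀ (by linarith)))
  have hx : 0 < q⁻¹ ^ m := by positivity
  have hx' : q⁻¹ ^ m / (q - 1) ≤ q⁻¹ ^ m := div_le_self hx.le (by linarith)
  have hx0 : 0 ≤ q⁻¹ ^ m / (q - 1) := by positivity
  rw [abs_le]
  constructor <;> nlinarith

theorem exp_lt_sq_of_limit_two {c : ℝ}
    (hc : Tendsto (fun n : ℕ => ∏ i ∈ Finset.Icc 1 n, (1 - (2 : ℝ)⁻¹ ^ i)) atTop (nhds c)) :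
    Real.exp (-23 / 9) < c ^ 2 := by
  have h1 := prod_Icc_mul_le_limit le_rfl hc 3
  have h2 : (0.287109 : ℝ) ≤ c := by
    refine le_trans ?_ h1
    rw [prod_Icc_one_eq_prod_range]
    norm_num [Finset.prod_range_succ]
  have h3 : (0.0824 : ℝ) ≤ c ^ 2 := by nlinarith
  have h4 : (12.2 : ℝ) < Real.exp (23 / 9) := by
    refine lt_of_pow_lt_pow_left₀ 9 (Real.exp_pos _).le ?_
    rw [← Real.exp_nat_mul, show ((9 : ℕ) : ℝ) * (23 / 9) = (23 : ℕ) * 1 by norm_num,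
      Real.exp_nat_mul]
    refine lt_of_lt_of_le ?_ (pow_le_pow_left₀ (by norm_num) Real.exp_one_gt_d9.le 23)
    norm_num
  rw [neg_div, Real.exp_neg]
  refine lt_of_lt_of_le ?_ h3
  rw [inv_lt_comm₀ (Real.exp_pos _) (by norm_num)]
  refine lt_trans ?_ h4
  norm_num

theorem exp_lt_pow_of_limit {q : ℕ} {c : ℝ} (hq : 2 ≤ q)
    (hc : Tendsto (fun n : ℕ => ∏ i ∈ Finset.Icc 1 n, (1 - (q : ℝ)⁻¹ ^ i)) atTop (nhds c)) :
    Real.exp (-23 / 9) < c ^ q := by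
  obtain rfl | hq3 := hq.eq_or_lt
  · exact exp_lt_sq_of_limit_two (by exact_mod_cast hc)
  have hr : (3 : ℝ) ≤ q := by exact_mod_cast hq3
  have h1 := prod_Icc_mul_le_limit (by linarith) hc 1
  obtain ⟨r, hrq⟩ : ∃ r : ℝ, r = q := ⟨_, rfl⟩
  rw [← hrq] at h1 hr
  have hD : 0 < r ^ 2 - r - 1 := by nlinarith
  have h2 : (r ^ 2 - r - 1) / r ^ 2 ≤ c := by
    refine le_trans (le_of_eq ?_) h1
    have hr1 : r - 1 ≠ 0 := by linarith
    simp only [Finset.Icc_self, Finset.prod_singleton, pow_one]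
    field_simp
  have h3 : Real.exp (-((r + 1) / (r ^ 2 - r - 1))) ≤ (r ^ 2 - r - 1) / r ^ 2 := by
    rw [Real.exp_neg]
    refine inv_le_of_inv_le₀ (by positivity) ?_
    rw [inv_div]
    refine le_trans (le_of_eq ?_) (Real.add_one_le_exp _)
    rw [div_add_one hD.ne']
    congr 1
    ring
  have h4 := pow_le_pow_left₀ (Real.exp_pos _).le (h3.trans h2) q
  refine lt_of_lt_of_le ?_ h4
  rw [← Real.exp_nat_mul, ← hrq, Real.exp_lt_exp, neg_div, mul_neg, neg_lt_neg_iff, ← mul_div_assoc,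
    div_lt_div_iff₀ hD (by norm_num)]
  nlinarith

theorem tendsto_vGL (K : Type*) [Field K] [Fintype K] {c : ℝ}
    (hc : Tendsto (fun n : ℕ => ∏ i ∈ Finset.Icc 1 n, (1 - ((Fintype.card K : ℝ))⁻¹ ^ i)) atTop
      (nhds c)) :
    Tendsto (fun n => vGL K n) atTop (nhds (c ^ (Fintype.card K - 1))) := by
  have hq : (2 : ℝ) ≤ Fintype.card K := by exact_mod_cast Fintype.one_lt_card (α := K)
  have h : Tendsto (fun n : ℕ => ((Fintype.card K : ℝ)⁻¹ ^ 2) ^ n) atTop (nhds 0) :=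
    tendsto_pow_atTop_nhds_zero_of_lt_one (by positivity)
      (pow_lt_one₀ (by positivity) (inv_lt_one_of_one_lt₀ (by linarith)) two_ne_zero)
  have h' := ((tendsto_add_atTop_iff_nat 1).2 h).const_mul
    ((Fintype.card K : ℝ) ^ (6 * (Fintype.card K - 1)))
  rw [mul_zero] at h'
  rw [tendsto_iff_dist_tendsto_zero]
  refine squeeze_zero (fun n => dist_nonneg) (fun n => ?_) h'
  rw [dist_comm, Real.dist_eq]
  exact abs_sub_vGL_le K hc n

theorem abs_limit_sub_alphaStar_le (K : Type*) [Field K] [Fintype K] {c : ℝ}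
    (hc : Tendsto (fun n : ℕ => ∏ i ∈ Finset.Icc 1 n, (1 - ((Fintype.card K : ℝ))⁻¹ ^ i)) atTop
      (nhds c)) {n : ℕ} (hn : 5 * (Fintype.card K - 1) ^ 2 < n) :
    |c ^ Fintype.card K - alphaStar K (Fintype.card K) (n + 1)| ≤
      2 * ((Fintype.card K : ℝ))⁻¹ ^ (n + 1) := by
  have hq1 : 1 < Fintype.card K := Fintype.one_lt_card
  have hq : (2 : ℝ) ≤ Fintype.card K := by exact_mod_cast hq1
  have hv := abs_sub_vGL_le K hc n
  have hP := abs_limit_sub_prod_Icc_le hq hc (n + 1)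
  have hc0 := limit_nonneg hq hc
  have hc1 : c ≤ 1 := by simpa using limit_le_prod_Icc hq hc 0
  have hv0 := vGL_nonneg K n
  have hv1 := vGL_le_one K n
  have he : 6 * (Fintype.card K - 1) ≤ n + 1 := by
    obtain ⟨m, hm⟩ : ∃ m, Fintype.card K - 1 = m + 1 := ⟨Fintype.card K - 2, by omega⟩
    rw [hm] at hn ⊢
    nlinarith
  have hv' : |c ^ (Fintype.card K - 1) - vGL K n| ≤ (Fintype.card K : ℝ)⁻¹ ^ (n + 1) := by
    refine hv.trans ?_
    rw [← pow_mul, two_mul, pow_add, ← mul_assoc]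
    refine mul_le_of_le_one_left (by positivity) ?_
    rw [inv_pow, ← div_eq_mul_inv]
    exact div_le_one_of_le₀ (pow_le_pow_right₀ (by linarith) he) (by positivity)
  rw [alphaStar_eq]
  have hsplit : c ^ Fintype.card K = c ^ (Fintype.card K - 1) * c := by
    rw [← pow_succ, Nat.sub_add_cancel hq1.le]
  set P := ∏ i ∈ Finset.Icc 1 (n + 1), (1 - ((Fintype.card K : ℝ))⁻¹ ^ i)
  calc _ = |(c ^ (Fintype.card K - 1) - vGL K n) * c + vGL K n * (c - P)| := by
        rw [hsplit]; congr 1; ring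
    _ ≤ |c ^ (Fintype.card K - 1) - vGL K n| * c + vGL K n * |c - P| := by
        refine (abs_add_le _ _).trans (le_of_eq ?_)
        rw [abs_mul, abs_mul, abs_of_nonneg hc0, abs_of_nonneg hv0]
    _ ≤ |c ^ (Fintype.card K - 1) - vGL K n| + |c - P| :=
        add_le_add (mul_le_of_le_one_right (abs_nonneg _) hc1)
          (mul_le_of_le_one_left (abs_nonneg _) hv1)
    _ ≤ _ := by linarith

/-- `α*(n, q) = v(GL, n−1, q)·c_n(q)`; the limit `α*(∞, q) = lim_n α*(n, q)` equals
`c(q)^q > e^{−23/9}`; and for every `n > 5(q−1)²`,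
`|α*(∞, q) − α*(n+1, q)| ≤ (1/2)·16^{q−1}·q^{−(n+1)(n+q)/(2(q−1))} + 4·q^{−(n+1)}`. -/
theorem stmt_10 (F : Type*) [Field F] [Fintype F] (q : ℕ) (hq : Fintype.card F = q) (c : ℝ)
    (hc : Tendsto (fun n : ℕ => ∏ i ∈ Finset.Icc 1 n, (1 - ((q : ℝ))⁻¹ ^ i)) atTop (nhds c)) :
    (∀ n : ℕ, 1 ≤ n →
        alphaStar F q n = vGL F (n - 1) * ∏ i ∈ Finset.Icc 1 n, (1 - ((q : ℝ))⁻¹ ^ i)) ∧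
    Tendsto (fun n : ℕ => alphaStar F q n) atTop (nhds (c ^ q)) ∧
    c ^ q > Real.exp (-23 / 9) ∧
    ∀ n : ℕ, 5 * (q - 1) ^ 2 < n →
      |c ^ q - alphaStar F q (n + 1)|
        ≤ (1 / 2) * 16 ^ (q - 1) *
            (q : ℝ) ^ (-(((n : ℝ) + 1) * ((n : ℝ) + (q : ℝ))) / (2 * ((q : ℝ) - 1)))
          + 4 * ((q : ℝ))⁻¹ ^ (n + 1) := by
  subst hq
  have hq1 : 1 < Fintype.card F := Fintype.one_lt_card
  refine ⟨fun n hn => ?_, ?_, exp_lt_pow_of_limit hq1 hc, fun n hn => ?_⟩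
  · obtain ⟨m, rfl⟩ := Nat.exists_eq_add_of_le' hn
    exact alphaStar_eq F m
  · rw [← tendsto_add_atTop_iff_nat 1]
    simp only [alphaStar_eq]
    have h := (tendsto_vGL F hc).mul ((tendsto_add_atTop_iff_nat 1).2 hc)
    rwa [← pow_succ, Nat.sub_add_cancel hq1.le] at h
  · have h := abs_limit_sub_alphaStar_le F hc hn
    refine h.trans (le_add_of_nonneg_of_le (by positivity) ?_)
    exact mul_le_mul_of_nonneg_right (by norm_num) (by positivity)
end

section
/- Let q be a prime power and define σ(n, q) := |{A ∈ M(n, F_q) : Tr(A²) = 0}| / q^{n²}. Then lim_{n→∞} σ(n, q) = 1/q, and for every n ≥ 1, |1/q − σ(n, q)| ≤ (q − 1)·q^{−n²/2 − 1}. -/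
open Matrix Filter

/-- The Gauss sum of a nondegenerate symmetric bilinear form in odd characteristic. -/
theorem norm_sq_sum_addChar_bilinForm {F V : Type*} [Field F] [Finite F] [AddCommGroup V]
    [Module F V] [Fintype V] (B : LinearMap.BilinForm F V) (hB : ∀ x y, B x y = B y x)
    (hnd : ∀ y, (∀ x, B x y = 0) → y = 0) (h2 : (2 : F) ≠ 0)
    {ψ : AddChar F ℂ} (hψ : ψ ≠ 1) :
    ‖∑ x, ψ (B x x)‖ ^ 2 = Fintype.card V := by
  classical
  have inner_sum (h : V) : ∑ b, ψ (2 * B b h) = if h = 0 then (Fintype.card V : ℂ) else 0 := by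
    split_ifs with h0
    · simp [h0]
    · obtain ⟨x, hx⟩ : ∃ x, B x h ≠ 0 := by
        by_contra! hcon
        exact h0 (hnd h hcon)
      obtain ⟨c, hc⟩ := (AddChar.ne_one_iff).1 hψ
      let χ : AddChar V ℂ := ψ.compAddMonoidHom ((2 : F) • B.flip h).toAddMonoidHom
      have hχ : χ ≠ 0 := by
        refine AddChar.ne_zero_iff.2 ⟨(c / (2 * B x h)) • x, ?_⟩
        have hcx : (2 : F) • B ((c / (2 * B x h)) • x) h = c := by
          rw [map_smul, LinearMap.smul_apply, smul_eq_mul, smul_eq_mul]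
          field_simp
        exact (congrArg ψ hcx).trans_ne hc
      simpa [χ] using AddChar.sum_eq_zero_iff_ne_zero.2 hχ
  have key : (∑ x, ψ (B x x)) * (starRingEnd ℂ) (∑ x, ψ (B x x)) = Fintype.card V := by
    calc (∑ x, ψ (B x x)) * (starRingEnd ℂ) (∑ x, ψ (B x x))
        = ∑ b, ∑ a, ψ (B a a) * ψ (-B b b) := by
          rw [map_sum, Finset.sum_mul_sum, Finset.sum_comm]
          simp [AddChar.map_neg_eq_conj]
      _ = ∑ b, ∑ h, ψ (B h h) * ψ (2 * B b h) := by
          refine Finset.sum_congr rfl fun b _ => ?_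
          rw [← Equiv.sum_comp (Equiv.addRight b)]
          refine Finset.sum_congr rfl fun h _ => ?_
          rw [← AddChar.map_add_eq_mul, ← AddChar.map_add_eq_mul]
          congr 1
          simp only [Equiv.coe_addRight, map_add, LinearMap.add_apply, hB h b]
          ring
      _ = ∑ h, ψ (B h h) * ∑ b, ψ (2 * B b h) := by
          rw [Finset.sum_comm]
          simp [Finset.mul_sum]
      _ = Fintype.card V := by simp [inner_sum]
  rw [Complex.mul_conj, Complex.normSq_eq_norm_sq] at key
  exact_mod_cast key

/-- A uniform bound on the nontrivial character sums of a function bounds the deviation of the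
size of its zero set from the expected one. -/
theorem abs_card_zeros_sub_le {F V : Type*} [AddCommGroup F] [Fintype F] [Fintype V]
    (Q : V → F) {C : ℝ} (hC : ∀ ψ : AddChar F ℂ, ψ ≠ 0 → ‖∑ x, ψ (Q x)‖ ≤ C) :
    |(Fintype.card V : ℝ) - Fintype.card F * Nat.card {x // Q x = 0}|
      ≤ (Fintype.card F - 1) * C := by
  classical
  have total : ∑ ψ : AddChar F ℂ, ∑ x, ψ (Q x)
      = (Fintype.card F : ℂ) * Nat.card {x // Q x = 0} := by
    rw [Finset.sum_comm]
    simp only [AddChar.sum_apply_eq_ite, Nat.card_eq_fintype_card, Fintype.card_subtype]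
    rw [← Finset.sum_filter]
    simp [mul_comm]
  rw [← Finset.add_sum_erase _ _ (Finset.mem_univ (0 : AddChar F ℂ))] at total
  have hsub : (((Fintype.card V : ℝ) - Fintype.card F * Nat.card {x // Q x = 0} : ℝ) : ℂ)
      = -∑ ψ ∈ Finset.univ.erase (0 : AddChar F ℂ), ∑ x, ψ (Q x) := by
    push_cast
    rw [← total]
    simp
  rw [← Real.norm_eq_abs, ← Complex.norm_real, hsub, norm_neg]
  refine (norm_sum_le_of_le _ fun ψ hψ => hC ψ (Finset.ne_of_mem_erase hψ)).trans_eq ?_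
  rw [Finset.sum_const, Finset.card_erase_of_mem (Finset.mem_univ _), Finset.card_univ,
    nsmul_eq_mul, AddChar.card_eq, Nat.cast_pred Fintype.card_pos]

/-- Square-root cancellation in the character sums of `A ↦ Tr(A²)`. -/
theorem norm_sum_addChar_trace_mul_self_le {F ι : Type*} [Field F] [Fintype F] [Fintype ι]
    [DecidableEq ι] [Nonempty ι] {ψ : AddChar F ℂ} (hψ : ψ ≠ 0) :
    ‖∑ A : Matrix ι ι F, ψ (A * A).trace‖ ≤ √(Fintype.card (Matrix ι ι F)) := by
  by_cases h2 : (2 : F) = 0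
  · have : CharP F 2 := CharTwo.of_one_ne_zero_of_two_eq_zero one_ne_zero h2
    let Q : Matrix ι ι F →+ F := AddMonoidHom.mk' (fun A => (A * A).trace) fun A B => by
      have := CharTwo.add_self_eq_zero (A * B).trace
      simp only [add_mul, mul_add, trace_add, trace_mul_comm B A]
      linear_combination this
    have hχ : ψ.compAddMonoidHom Q ≠ 0 := by
      obtain ⟨c, hc⟩ := AddChar.ne_zero_iff.1 hψ
      obtain ⟨r, rfl⟩ := FiniteField.isSquare_of_char_two (ringChar.eq F 2) c
      let i : ι := Classical.arbitrary ι
      exact AddChar.ne_zero_iff.2 ⟨single i i r, by simpa [Q] using hc⟩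
    have hsum : ∑ A : Matrix ι ι F, ψ (A * A).trace = 0 :=
      AddChar.sum_eq_zero_iff_ne_zero.2 hχ
    rw [hsum, norm_zero]
    positivity
  · let B : LinearMap.BilinForm F (Matrix ι ι F) :=
      (LinearMap.mul F (Matrix ι ι F)).compr₂ (traceLinearMap ι F F)
    refine Real.le_sqrt_of_sq_le
      (norm_sq_sum_addChar_bilinForm B (fun x y => trace_mul_comm x y) ?_ h2 hψ).le
    intro y hy
    exact ext_iff_trace_mul_left.2 fun x => by simpa [B] using hy x

/-- `σ(n, q)`, the proportion of self-dual matrices (those with `Tr(A²) = 0`) in `M(n, F_q)`,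
tends to `1/q` as `n → ∞`, and for every `n ≥ 1`,
`|1/q − σ(n, q)| ≤ (q − 1)·q^{−n²/2 − 1}`. -/
theorem stmt_11 (F : Type*) [Field F] [Fintype F] (q : ℕ) (hq : Fintype.card F = q) :
    Tendsto (fun n : ℕ =>
        (Nat.card {A : Matrix (Fin n) (Fin n) F // (A * A).trace = 0} : ℝ) / (q : ℝ) ^ (n ^ 2))
      atTop (nhds (1 / (q : ℝ))) ∧
    ∀ n : ℕ, 1 ≤ n →
      |1 / (q : ℝ) -
          (Nat.card {A : Matrix (Fin n) (Fin n) F // (A * A).trace = 0} : ℝ) / (q : ℝ) ^ (n ^ 2)|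
        ≤ ((q : ℝ) - 1) * (q : ℝ) ^ (-((n : ℝ) ^ 2) / 2 - 1) := by
  classical
  have hq1 : (1 : ℝ) < q := by exact_mod_cast hq ▸ Fintype.one_lt_card (α := F)
  have hq0 : (0 : ℝ) < q := by linarith
  have bound : ∀ n : ℕ, 1 ≤ n →
      |1 / (q : ℝ) -
          (Nat.card {A : Matrix (Fin n) (Fin n) F // (A * A).trace = 0} : ℝ) / (q : ℝ) ^ (n ^ 2)|
        ≤ ((q : ℝ) - 1) * (q : ℝ) ^ (-((n : ℝ) ^ 2) / 2 - 1) := by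
    intro n hn
    have : NeZero n := ⟨by omega⟩
    have hcard : Fintype.card (Matrix (Fin n) (Fin n) F) = q ^ n ^ 2 := by
      rw [← Nat.card_eq_fintype_card]
      simp [Matrix, hq, ← pow_mul, sq]
    have h := abs_card_zeros_sub_le (fun A : Matrix (Fin n) (Fin n) F => (A * A).trace)
      fun ψ hψ => norm_sum_addChar_trace_mul_self_le hψ
    rw [hcard, hq] at h
    push_cast at h
    set N : ℝ := (Nat.card {A : Matrix (Fin n) (Fin n) F // (A * A).trace = 0} : ℝ)
    have hP : (0 : ℝ) < (q : ℝ) ^ n ^ 2 := by positivity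
    have hdiv : 1 / (q : ℝ) - N / (q : ℝ) ^ n ^ 2
        = ((q : ℝ) ^ n ^ 2 - q * N) / (q * (q : ℝ) ^ n ^ 2) := by
      field_simp
    have hsqrt : √((q : ℝ) ^ n ^ 2) = (q : ℝ) ^ ((n : ℝ) ^ 2 / 2) := by
      rw [Real.sqrt_eq_rpow, ← Real.rpow_natCast (q : ℝ), ← Real.rpow_mul hq0.le]
      push_cast
      ring_nf
    have hpow : (q : ℝ) ^ (-((n : ℝ) ^ 2) / 2 - 1) * (q * (q : ℝ) ^ n ^ 2)
        = (q : ℝ) ^ ((n : ℝ) ^ 2 / 2) := by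
      rw [← Real.rpow_natCast (q : ℝ), ← Real.rpow_one_add' hq0.le (by positivity),
        ← Real.rpow_add hq0]
      push_cast
      ring_nf
    rw [hdiv, abs_div, abs_of_pos (mul_pos hq0 hP), div_le_iff₀ (mul_pos hq0 hP), mul_assoc,
      hpow, ← hsqrt]
    exact h
  refine ⟨?_, bound⟩
  have hexp : Tendsto (fun n : ℕ => -((n : ℝ) ^ 2) / 2 - 1) atTop atBot := by
    have hsq : Tendsto (fun n : ℕ => (n : ℝ) ^ 2 / 2 + 1) atTop atTop :=
      tendsto_atTop_add_const_right _ _ <| Tendsto.atTop_div_const two_pos <|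
        (tendsto_pow_atTop two_ne_zero).comp tendsto_natCast_atTop_atTop
    refine (tendsto_neg_atTop_atBot.comp hsq).congr fun n => ?_
    simp only [Function.comp_apply]
    ring
  have hlim : Tendsto (fun n : ℕ => ((q : ℝ) - 1) * (q : ℝ) ^ (-((n : ℝ) ^ 2) / 2 - 1))
      atTop (nhds 0) := by
    simpa using ((tendsto_rpow_atBot_of_base_gt_one (q : ℝ) hq1).comp hexp).const_mul ((q : ℝ) - 1)
  refine tendsto_iff_dist_tendsto_zero.2 (squeeze_zero' (.of_forall fun _ => dist_nonneg) ?_ hlim)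
  filter_upwards [eventually_ge_atTop 1] with n hn
  rw [dist_comm, Real.dist_eq]
  exact bound n hn
end

section
/- Let q be a prime power and, for k ∈ F_q, define β(n, q, k) := |{A ∈ GL(n, F_q) : the characteristic polynomial of A has no roots in F_q, and Tr(A²) = k}| / |GL(n, F_q)|. Then for every k ∈ F_q the limit β(∞, q, k) := lim_{n→∞} β(n, q, k) exists and equals (1/q)·c(q)^{q−1}. Moreover, for every n ≥ 5(q−1)² and every k ∈ F_q, |β(∞, q, k) − β(n, q, k)| ≤ Γ(n, q), where Γ(n, q) := (1/2)·16^{q−1}·q^{−(n+1)(n+q)/(2(q−1)) − 1} + (n+1)²·binomial(n+q−2, q−2)·(q/(q−1))^n·q^{−n²/(2(q+1)) + (q−1)n/(2(q+1)) + (q−1)/(4(q+1))}. -/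
open Matrix Polynomial Filter

/-- `β(n, q, k)`: the proportion of matrices in `GL(n, F_q)` that are eigenvalue-free
(characteristic polynomial with no roots in `F_q`) and satisfy `Tr(A²) = k`. -/
noncomputable def betaGL (F : Type*) [Field F] [Fintype F] (n : ℕ) (k : F) : ℝ :=
  (Nat.card {A : (Matrix (Fin n) (Fin n) F)ˣ //
      (∀ t : F, ((A.val : Matrix (Fin n) (Fin n) F).charpoly).eval t ≠ 0) ∧
      (A.val * A.val).trace = k} : ℝ)
    / (Nat.card (Matrix (Fin n) (Fin n) F)ˣ : ℝ)

/-- The error term `Γ(n, q)`. -/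
noncomputable def gammaErr (q n : ℕ) : ℝ :=
  (1 / 2) * 16 ^ (q - 1) *
      (q : ℝ) ^ (-(((n : ℝ) + 1) * ((n : ℝ) + (q : ℝ))) / (2 * ((q : ℝ) - 1)) - 1)
    + ((n : ℝ) + 1) ^ 2 * (Nat.choose (n + q - 2) (q - 2) : ℝ) * ((q : ℝ) / ((q : ℝ) - 1)) ^ n *
      (q : ℝ) ^ (-((n : ℝ) ^ 2) / (2 * ((q : ℝ) + 1)) + ((q : ℝ) - 1) * (n : ℝ) / (2 * ((q : ℝ) + 1))
        + ((q : ℝ) - 1) / (4 * ((q : ℝ) + 1)))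

section Fitting

variable {F : Type*} [Field F] {V W V' W' : Type*}
  [AddCommGroup V'] [Module F V'] [AddCommGroup W'] [Module F W']
  [AddCommGroup V] [Module F V] [AddCommGroup W] [Module F W]

/-- An intertwiner from a nilpotent endomorphism to an invertible one vanishes. -/
theorem eq_zero_of_intertwines_nilpotent_unit {P : Module.End F V} {N : Module.End F W}
    {h : W →ₗ[F] V} (hc : P ∘ₗ h = h ∘ₗ N) (hP : IsUnit P) (hN : IsNilpotent N) : h = 0 := by
  obtain ⟨k, hk⟩ := hN
  have h1 := Module.End.commute_pow_left_of_commute hc k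
  rw [hk, LinearMap.comp_zero] at h1
  have hinj : Function.Injective (P ^ k : Module.End F V) :=
    ((Module.End.isUnit_iff _).1 (hP.pow k)).1
  ext x
  apply hinj
  simpa using LinearMap.congr_fun h1 x

/-- An intertwiner from an invertible endomorphism to a nilpotent one vanishes. -/
theorem eq_zero_of_intertwines_unit_nilpotent {P : Module.End F V} {N : Module.End F W}
    {h : V →ₗ[F] W} (hc : N ∘ₗ h = h ∘ₗ P) (hP : IsUnit P) (hN : IsNilpotent N) : h = 0 := by
  obtain ⟨k, hk⟩ := hN
  have h1 := Module.End.commute_pow_left_of_commute hc k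
  rw [hk, LinearMap.zero_comp] at h1
  have hsurj : Function.Surjective (P ^ k : Module.End F V) :=
    ((Module.End.isUnit_iff _).1 (hP.pow k)).2
  ext x
  obtain ⟨y, rfl⟩ := hsurj x
  simpa using (LinearMap.congr_fun h1 y).symm

/-- An isomorphism between two Fitting decompositions is block diagonal. -/
theorem exists_eq_prodCongr_of_intertwines (h : (V × W) ≃ₗ[F] (V' × W'))
    {B : Module.End F V} {C : Module.End F W} {B' : Module.End F V'} {C' : Module.End F W'}
    (hc : ∀ x, h (B.prodMap C x) = B'.prodMap C' (h x))
    (hB : IsUnit B) (hC : IsNilpotent C) (hB' : IsUnit B') (hC' : IsNilpotent C') :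
    ∃ (h₁ : V ≃ₗ[F] V') (h₂ : W ≃ₗ[F] W'), h = h₁.prodCongr h₂ := by
  have hc' : ∀ x, h.symm (B'.prodMap C' x) = B.prodMap C (h.symm x) := fun x => by
    rw [LinearEquiv.symm_apply_eq, hc, h.apply_symm_apply]
  have e12 : LinearMap.fst F V' W' ∘ₗ h.toLinearMap ∘ₗ LinearMap.inr F V W = 0 := by
    refine eq_zero_of_intertwines_nilpotent_unit (P := B') (N := C) ?_ hB' hC
    ext x
    simpa using (congrArg Prod.fst (hc (0, x))).symm
  have e21 : LinearMap.snd F V' W' ∘ₗ h.toLinearMap ∘ₗ LinearMap.inl F V W = 0 := by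
    refine eq_zero_of_intertwines_unit_nilpotent (P := B) (N := C') ?_ hB hC'
    ext x
    simpa using (congrArg Prod.snd (hc (x, 0))).symm
  have e12' : LinearMap.fst F V W ∘ₗ h.symm.toLinearMap ∘ₗ LinearMap.inr F V' W' = 0 := by
    refine eq_zero_of_intertwines_nilpotent_unit (P := B) (N := C') ?_ hB hC'
    ext x
    simpa using (congrArg Prod.fst (hc' (0, x))).symm
  have e21' : LinearMap.snd F V W ∘ₗ h.symm.toLinearMap ∘ₗ LinearMap.inl F V' W' = 0 := by
    refine eq_zero_of_intertwines_unit_nilpotent (P := B') (N := C) ?_ hB' hC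
    ext x
    simpa using (congrArg Prod.snd (hc' (x, 0))).symm
  have f12 : ∀ w, h (0, w) = (0, (h (0, w)).2) := fun w =>
    Prod.ext (by simpa using LinearMap.congr_fun e12 w) rfl
  have f21 : ∀ v, h (v, 0) = ((h (v, 0)).1, 0) := fun v =>
    Prod.ext rfl (by simpa using LinearMap.congr_fun e21 v)
  have f12' : ∀ w, h.symm (0, w) = (0, (h.symm (0, w)).2) := fun w =>
    Prod.ext (by simpa using LinearMap.congr_fun e12' w) rfl
  have f21' : ∀ v, h.symm (v, 0) = ((h.symm (v, 0)).1, 0) := fun v =>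
    Prod.ext rfl (by simpa using LinearMap.congr_fun e21' v)
  refine ⟨LinearEquiv.ofLinearMap (LinearMap.fst F V' W' ∘ₗ h.toLinearMap ∘ₗ LinearMap.inl F V W)
    (LinearMap.fst F V W ∘ₗ h.symm.toLinearMap ∘ₗ LinearMap.inl F V' W') ?_ ?_,
    LinearEquiv.ofLinearMap (LinearMap.snd F V' W' ∘ₗ h.toLinearMap ∘ₗ LinearMap.inr F V W)
    (LinearMap.snd F V W ∘ₗ h.symm.toLinearMap ∘ₗ LinearMap.inr F V' W') ?_ ?_, ?_⟩
  · ext v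
    simp [← f21']
  · ext v
    simp [← f21]
  · ext v
    simp [← f12']
  · ext v
    simp [← f12]
  · ext x : 1
    obtain ⟨v, w⟩ := x
    have : h (v, w) = h (v, 0) + h (0, w) := by rw [← map_add]; simp
    rw [this, f21, f12]
    simp

theorem prodMap_sub_algebraMap (a : F) (B : Module.End F V) (C : Module.End F W) :
    B.prodMap C - algebraMap F (Module.End F (V × W)) a =
      (B - algebraMap F (Module.End F V) a).prodMap (C - algebraMap F (Module.End F W) a) := by
  ext x <;> simp [Algebra.algebraMap_eq_smul_one]

theorem isUnit_prodMap_iff {B : Module.End F V} {C : Module.End F W} :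
    IsUnit (B.prodMap C : Module.End F (V × W)) ↔ IsUnit B ∧ IsUnit C := by
  simp only [Module.End.isUnit_iff]
  have : (⇑(B.prodMap C : Module.End F (V × W)) : V × W → V × W) = Prod.map B C := rfl
  rw [this, Prod.map_bijective]

theorem isUnit_conj_iff (e : V ≃ₗ[F] V') {T : Module.End F V} :
    IsUnit (e.conj T) ↔ IsUnit T := by
  have : e.conj T = e.conjRingEquiv T := rfl
  rw [this]
  exact MulEquiv.isUnit_map _

theorem conj_sub_algebraMap (e : V ≃ₗ[F] V') (a : F) (T : Module.End F V) :
    e.conj T - algebraMap F (Module.End F V') a = e.conj (T - algebraMap F (Module.End F V) a) := by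
  ext x; simp [Algebra.algebraMap_eq_smul_one, LinearEquiv.conj_apply]

theorem LinearMap.finite_of_finite [Finite V] [Finite V'] : Finite (V →ₗ[F] V') :=
  DFunLike.finite _

/-- The Fitting decomposition of an endomorphism with respect to a scalar `a`. -/
theorem exists_fitting (a : F) (n : ℕ) (T : Module.End F (Fin n → F)) :
    ∃ p ∈ Finset.HasAntidiagonal.antidiagonal n,
      ∃ (B : Module.End F (Fin p.1 → F)) (C : Module.End F (Fin p.2 → F))
      (g : ((Fin p.1 → F) × (Fin p.2 → F)) ≃ₗ[F] (Fin n → F)),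
      IsUnit (B - algebraMap F _ a) ∧ IsNilpotent (C - algebraMap F _ a) ∧
      g.conj (B.prodMap C) = T := by
  set S := T - algebraMap F _ a with hS
  obtain ⟨k, hk⟩ := (LinearMap.eventually_isCompl_ker_pow_range_pow S).and
    (eventually_ge_atTop 1) |>.exists
  obtain ⟨hk, hk1⟩ := hk
  set K := LinearMap.ker (S ^ k)
  set R := LinearMap.range (S ^ k)
  have hTS : Commute T (S ^ k) := by
    apply Commute.pow_right
    rw [hS]
    exact (Commute.refl T).sub_right (Algebra.commutes a T).symm
  have hR : ∀ x ∈ R, T x ∈ R := by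
    rintro _ ⟨y, rfl⟩
    exact ⟨T y, by simpa using (LinearMap.congr_fun hTS.eq y).symm⟩
  have hK : ∀ x ∈ K, T x ∈ K := by
    intro x hx
    rw [LinearMap.mem_ker] at hx ⊢
    have := (LinearMap.congr_fun hTS.eq x)
    simp only [Module.End.mul_apply] at this
    rw [← this, hx, map_zero]
  let eR := (Module.finBasis F R).equivFun.symm
  let eK := (Module.finBasis F K).equivFun.symm
  let g0 := (eR.prodCongr eK).trans (Submodule.prodEquivOfIsCompl R K hk.symm)
  have hsum : Module.finrank F R + Module.finrank F K = n := by
    have := g0.finrank_eq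
    simpa using this
  refine ⟨(Module.finrank F R, Module.finrank F K), by simpa using hsum,
    eR.symm.conj (T.restrict hR), eK.symm.conj (T.restrict hK), g0, ?_, ?_, ?_⟩
  · rw [conj_sub_algebraMap, isUnit_conj_iff, LinearMap.isUnit_iff_ker_eq_bot, LinearMap.ker_eq_bot']
    intro x hx
    have hx' : S x = 0 := by
      have := congrArg Subtype.val hx
      simpa [hS, Algebra.algebraMap_eq_smul_one] using this
    have hxK : (x : Fin n → F) ∈ K := by
      obtain ⟨m, rfl⟩ : ∃ m, k = m + 1 := ⟨k - 1, by omega⟩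
      rw [LinearMap.mem_ker, pow_succ, Module.End.mul_apply, hx', map_zero]
    have := (Submodule.disjoint_def.1 hk.disjoint) _ hxK x.2
    exact Subtype.ext this
  · have : T.restrict hK - algebraMap F _ a = LinearMap.restrict S (p := K) (q := K) (by
        intro x hx
        rw [hS]
        exact K.sub_mem (hK x hx) (by
          simpa [Algebra.algebraMap_eq_smul_one] using K.smul_mem a hx)) := by
      ext x; simp [hS, Algebra.algebraMap_eq_smul_one]
    rw [conj_sub_algebraMap, this]
    refine ⟨k, ?_⟩
    have h2 : ∀ X : Module.End F K, (eK.symm.conj X) ^ k = eK.symm.conj (X ^ k) := fun X =>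
      (map_pow eK.symm.conjRingEquiv X k).symm
    rw [h2, Module.End.pow_restrict]
    have : LinearMap.restrict (S ^ k) (p := K) (q := K) (fun x hx => by
        rw [LinearMap.mem_ker.1 hx]; exact K.zero_mem) = 0 := by
      ext x : 2
      simp
    rw [this, map_zero]
  · have key : ∀ y, g0 (((eR.symm.conj (T.restrict hR)).prodMap (eK.symm.conj (T.restrict hK))) y)
        = T (g0 y) := by
      rintro ⟨y, z⟩
      simp [g0, LinearEquiv.conj_apply]
    refine LinearMap.ext fun x => ?_
    rw [LinearEquiv.conj_apply_apply, key, LinearEquiv.apply_symm_apply]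

theorem conj_pair_injective (e : V ≃ₗ[F] V') {T T' : Module.End F V} (h : e.conj T = e.conj T') :
    T = T' := e.conj.injective h

theorem LinearEquiv.finite_of_finite [Finite V] [Finite V'] : Finite (V ≃ₗ[F] V') :=
  DFunLike.finite _

/-- The order of the general linear group of `F ^ m`. -/
noncomputable def cardGL (F : Type*) [Field F] (m : ℕ) : ℕ :=
  Nat.card ((Fin m → F) ≃ₗ[F] (Fin m → F))

/-- Fitting data of type `p`: an endomorphism of `F ^ p.1` without the eigenvalue `a`, one of
`F ^ p.2` with only the eigenvalue `a`, and an isomorphism `F ^ p.1 × F ^ p.2 ≃ F ^ n`. -/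
abbrev FittingData (F : Type*) [Field F] (a : F) (n : ℕ) (p : ℕ × ℕ) : Type _ :=
  {B : Module.End F (Fin p.1 → F) // IsUnit (B - algebraMap F _ a)} ×
  {C : Module.End F (Fin p.2 → F) // IsNilpotent (C - algebraMap F _ a)} ×
  (((Fin p.1 → F) × (Fin p.2 → F)) ≃ₗ[F] (Fin n → F))

/-- The endomorphism assembled from Fitting data. -/
def FittingData.toEnd {a : F} {n : ℕ} {p : ℕ × ℕ} (y : FittingData F a n p) :
    Module.End F (Fin n → F) :=
  y.2.2.conj ((y.1 : Module.End F _).prodMap (y.2.1 : Module.End F _))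

/-- Two Fitting data for the same endomorphism differ by block isomorphisms. -/
theorem FittingData.exists_prodCongr {a : F} {n : ℕ} {p p' : ℕ × ℕ} (y : FittingData F a n p)
    (y' : FittingData F a n p') (h : y.toEnd = y'.toEnd) :
    ∃ (h₁ : (Fin p.1 → F) ≃ₗ[F] (Fin p'.1 → F)) (h₂ : (Fin p.2 → F) ≃ₗ[F] (Fin p'.2 → F)),
      y.2.2.trans y'.2.2.symm = h₁.prodCongr h₂ := by
  refine exists_eq_prodCongr_of_intertwines _
    (B := y.1.1 - algebraMap F _ a) (C := y.2.1.1 - algebraMap F _ a)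
    (B' := y'.1.1 - algebraMap F _ a) (C' := y'.2.1.1 - algebraMap F _ a)
    (fun x => ?_) y.1.2 y.2.1.2 y'.1.2 y'.2.1.2
  rw [← prodMap_sub_algebraMap, ← prodMap_sub_algebraMap]
  have h1 := LinearMap.congr_fun h (y.2.2 x)
  simp only [FittingData.toEnd, LinearEquiv.conj_apply_apply, LinearEquiv.symm_apply_apply] at h1
  simp only [LinearMap.sub_apply, map_sub, LinearEquiv.trans_apply,
    Algebra.algebraMap_eq_smul_one, LinearMap.smul_apply, Module.End.one_apply, map_smul]
  rw [h1, LinearEquiv.symm_apply_apply]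

/-- Changing Fitting data by block automorphisms. -/
def FittingData.act {a : F} {n : ℕ} {p : ℕ × ℕ} (y : FittingData F a n p)
    (h : ((Fin p.1 → F) ≃ₗ[F] (Fin p.1 → F)) × ((Fin p.2 → F) ≃ₗ[F] (Fin p.2 → F))) :
    FittingData F a n p :=
  ⟨⟨h.1.conj y.1.1, by rw [conj_sub_algebraMap, isUnit_conj_iff]; exact y.1.2⟩,
    ⟨h.2.conj y.2.1.1, by
      rw [conj_sub_algebraMap]; exact y.2.1.2.map h.2.conjRingEquiv⟩,
    (h.1.prodCongr h.2).symm.trans y.2.2⟩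

theorem FittingData.toEnd_act {a : F} {n : ℕ} {p : ℕ × ℕ} (y : FittingData F a n p)
    (h : ((Fin p.1 → F) ≃ₗ[F] (Fin p.1 → F)) × ((Fin p.2 → F) ≃ₗ[F] (Fin p.2 → F))) :
    (y.act h).toEnd = y.toEnd := by
  refine LinearMap.ext fun x => ?_
  simp only [FittingData.toEnd, FittingData.act, LinearEquiv.conj_apply_apply,
    LinearEquiv.symm_trans_apply, LinearEquiv.trans_apply, LinearEquiv.symm_symm]
  congr 1
  rw [LinearEquiv.symm_apply_eq]
  simp [LinearEquiv.conj_apply]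

theorem FittingData.act_injective {a : F} {n : ℕ} {p : ℕ × ℕ} (y : FittingData F a n p) :
    Function.Injective y.act := by
  rintro ⟨h₁, h₂⟩ ⟨h₁', h₂'⟩ h
  have h3 : (h₁.prodCongr h₂).symm.trans y.2.2 = (h₁'.prodCongr h₂').symm.trans y.2.2 :=
    congrArg (fun z => z.2.2) h
  have h4 : ∀ x, (h₁.prodCongr h₂).symm x = (h₁'.prodCongr h₂').symm x := fun x =>
    y.2.2.injective (LinearEquiv.congr_fun h3 x)
  have h5 : h₁.prodCongr h₂ = h₁'.prodCongr h₂' := by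
    rw [← LinearEquiv.symm_symm (h₁.prodCongr h₂), LinearEquiv.ext h4, LinearEquiv.symm_symm]
  refine Prod.ext (LinearEquiv.ext fun x => ?_) (LinearEquiv.ext fun x => ?_)
  · simpa using congrArg Prod.fst (LinearEquiv.congr_fun h5 (x, 0))
  · simpa using congrArg Prod.snd (LinearEquiv.congr_fun h5 (0, x))

theorem FittingData.exists_act_eq {a : F} {n : ℕ} {p : ℕ × ℕ} (y y' : FittingData F a n p)
    (h : y.toEnd = y'.toEnd) : ∃ k, y.act k = y' := by
  obtain ⟨h₁, h₂, hh⟩ := y.exists_prodCongr y' h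
  have hg : y'.2.2 = (h₁.prodCongr h₂).symm.trans y.2.2 := by
    rw [← hh]; ext x; simp
  have hg' : (y.act (h₁, h₂)).2.2 = y'.2.2 := hg.symm
  have hT := (y.toEnd_act (h₁, h₂)).trans h
  simp only [FittingData.toEnd] at hT
  rw [hg'] at hT
  have h6 := conj_pair_injective _ hT
  refine ⟨(h₁, h₂), Prod.ext (Subtype.ext (LinearMap.ext fun x => ?_))
    (Prod.ext (Subtype.ext (LinearMap.ext fun x => ?_)) hg')⟩
  · simpa using congrArg Prod.fst (LinearMap.congr_fun h6 (x, 0))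
  · simpa using congrArg Prod.snd (LinearMap.congr_fun h6 (0, x))

theorem card_prod_linearEquiv {n : ℕ} {p : ℕ × ℕ} (hp : p.1 + p.2 = n) :
    Nat.card (((Fin p.1 → F) × (Fin p.2 → F)) ≃ₗ[F] (Fin n → F)) = cardGL F n := by
  have e : ((Fin p.1 → F) × (Fin p.2 → F)) ≃ₗ[F] (Fin n → F) :=
    LinearEquiv.ofFinrankEq _ _ (by simpa using hp)
  exact Nat.card_congr
    ⟨fun g => e.symm.trans g, fun g => e.trans g, fun g => by ext : 1; simp, fun g => by ext; simp⟩

section Counting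

variable [Fintype F]

noncomputable instance fintypeEndFin (m : ℕ) : Fintype (Module.End F (Fin m → F)) :=
  have := LinearMap.finite_of_finite (F := F) (V := Fin m → F) (V' := Fin m → F)
  Fintype.ofFinite _

theorem cardGL_pos (m : ℕ) : 0 < cardGL F m := by
  have := LinearEquiv.finite_of_finite (F := F) (V := Fin m → F) (V' := Fin m → F)
  have : Nonempty ((Fin m → F) ≃ₗ[F] (Fin m → F)) := ⟨LinearEquiv.refl F _⟩
  exact Nat.card_pos

instance FittingData.finite {a : F} {n : ℕ} {p : ℕ × ℕ} : Finite (FittingData F a n p) :=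
  have := LinearEquiv.finite_of_finite (F := F) (V := (Fin p.1 → F) × (Fin p.2 → F))
    (V' := Fin n → F)
  inferInstance

noncomputable instance FittingData.fintype {a : F} {n : ℕ} {p : ℕ × ℕ} :
    Fintype (FittingData F a n p) := Fintype.ofFinite _

open Classical in
/-- Each endomorphism has, counted with the appropriate weights, exactly one Fitting
decomposition. -/
theorem sum_card_fiber_toEnd (a : F) (n : ℕ) (T : Module.End F (Fin n → F)) :
    ∑ p ∈ Finset.HasAntidiagonal.antidiagonal n,
      ((Finset.univ.filter fun y : FittingData F a n p => y.toEnd = T).card : ℂ) /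
        (cardGL F p.1 * cardGL F p.2) = 1 := by
  obtain ⟨p₀, hp₀, B, C, g, hB, hC, hg⟩ := exists_fitting a n T
  let y₀ : FittingData F a n p₀ := (⟨B, hB⟩, ⟨C, hC⟩, g)
  have hy₀ : y₀.toEnd = T := hg
  rw [Finset.sum_eq_single_of_mem p₀ hp₀]
  · have hcard : (Finset.univ.filter fun y : FittingData F a n p₀ => y.toEnd = T).card =
        cardGL F p₀.1 * cardGL F p₀.2 := by
      rw [cardGL, cardGL, ← Nat.card_prod, ← Fintype.card_subtype, ← Nat.card_eq_fintype_card]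
      refine (Nat.card_congr (Equiv.ofBijective
        (fun k => (⟨y₀.act k, (y₀.toEnd_act k).trans hy₀⟩ :
          {y : FittingData F a n p₀ // y.toEnd = T})) ⟨?_, ?_⟩)).symm
      · intro k k' h
        exact y₀.act_injective (congrArg Subtype.val h)
      · rintro ⟨y, hy⟩
        obtain ⟨k, hk⟩ := y₀.exists_act_eq y (hy₀.trans hy.symm)
        exact ⟨k, Subtype.ext hk⟩
    rw [hcard]
    have h1 : (cardGL F p₀.1 : ℂ) ≠ 0 := by exact_mod_cast (cardGL_pos (F := F) p₀.1).ne'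
    have h2 : (cardGL F p₀.2 : ℂ) ≠ 0 := by exact_mod_cast (cardGL_pos (F := F) p₀.2).ne'
    push_cast
    exact div_self (mul_ne_zero h1 h2)
  · intro p hp hne
    have : (Finset.univ.filter fun y : FittingData F a n p => y.toEnd = T) = ∅ := by
      refine Finset.filter_eq_empty_iff.2 fun y _ hy => hne ?_
      obtain ⟨h₁, h₂, -⟩ := y.exists_prodCongr y₀ (hy.trans hy₀.symm)
      exact Prod.ext (by simpa using h₁.finrank_eq) (by simpa using h₂.finrank_eq)
    simp [this]

open Classical in
/-- Summing over all endomorphisms by means of the Fitting decomposition at `a`. -/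
theorem sum_end_eq_sum_fitting (a : F) (n : ℕ) (f : Module.End F (Fin n → F) → ℂ)
    (f₁ : ∀ m : ℕ, Module.End F (Fin m → F) → ℂ) (f₂ : ∀ m : ℕ, Module.End F (Fin m → F) → ℂ)
    (hf : ∀ p, ∀ y : FittingData F a n p, f y.toEnd = f₁ p.1 y.1.1 * f₂ p.2 y.2.1.1) :
    (∑ T, f T) / cardGL F n = ∑ p ∈ Finset.HasAntidiagonal.antidiagonal n,
      ((∑ B with IsUnit (B - algebraMap F _ a), f₁ p.1 B) / cardGL F p.1) *
      ((∑ C with IsNilpotent (C - algebraMap F _ a), f₂ p.2 C) / cardGL F p.2) := by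
  have hn : (cardGL F n : ℂ) ≠ 0 := by exact_mod_cast (cardGL_pos (F := F) n).ne'
  rw [div_eq_iff hn]
  calc ∑ T, f T = ∑ T, ∑ p ∈ Finset.HasAntidiagonal.antidiagonal n,
        f T * (((Finset.univ.filter fun y : FittingData F a n p => y.toEnd = T).card : ℂ) /
          (cardGL F p.1 * cardGL F p.2)) := by
        simp_rw [← Finset.mul_sum, sum_card_fiber_toEnd, mul_one]
    _ = ∑ p ∈ Finset.HasAntidiagonal.antidiagonal n,
        (∑ y : FittingData F a n p, f y.toEnd) / (cardGL F p.1 * cardGL F p.2) := by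
        rw [Finset.sum_comm]
        refine Finset.sum_congr rfl fun p _ => ?_
        rw [← Finset.sum_fiberwise (s := Finset.univ)
          (g := fun y : FittingData F a n p => y.toEnd), Finset.sum_div]
        refine Finset.sum_congr rfl fun T _ => ?_
        rw [Finset.sum_congr rfl (g := fun _ => f T)
          (fun y hy => by rw [(Finset.mem_filter.1 hy).2]), Finset.sum_const, nsmul_eq_mul]
        ring
    _ = _ := by
        rw [Finset.sum_mul]
        refine Finset.sum_congr rfl fun p hp => ?_
        have hE : ∑ y : FittingData F a n p, f y.toEnd =
            (∑ B with IsUnit (B - algebraMap F _ a), f₁ p.1 B) *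
            (∑ C with IsNilpotent (C - algebraMap F _ a), f₂ p.2 C) * cardGL F n := by
          have := LinearEquiv.finite_of_finite (F := F) (V := (Fin p.1 → F) × (Fin p.2 → F))
            (V' := Fin n → F)
          let _ := Fintype.ofFinite (((Fin p.1 → F) × (Fin p.2 → F)) ≃ₗ[F] (Fin n → F))
          rw [Finset.sum_congr rfl (fun y _ => hf p y),
            ← card_prod_linearEquiv (Finset.HasAntidiagonal.mem_antidiagonal.1 hp),
            Nat.card_eq_fintype_card,
            Finset.sum_subtype (p := fun B => IsUnit (B - algebraMap F _ a)) _ (by simp) (f₁ p.1),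
            Finset.sum_subtype (p := fun C => IsNilpotent (C - algebraMap F _ a)) _ (by simp)
              (f₂ p.2)]
          rw [Finset.sum_mul_sum, Finset.sum_mul]
          rw [show (FittingData.fintype : Fintype (FittingData F a n p)) =
            instFintypeProd _ _ from Subsingleton.elim _ _]
          rw [Fintype.sum_prod_type]
          refine Finset.sum_congr rfl fun B _ => ?_
          rw [Fintype.sum_prod_type, Finset.sum_mul]
          refine Finset.sum_congr rfl fun C _ => ?_
          simp [mul_comm]
        rw [hE]
        field_simp

end Counting

end Fitting

section QProd

/-- The finite product `∏_{i=1}^n (1 - q⁻ⁱ)`. -/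
noncomputable def qProd (q : ℝ) (n : ℕ) : ℝ := ∏ i ∈ Finset.Icc 1 n, (1 - q⁻¹ ^ i)

theorem qProd_zero (q : ℝ) : qProd q 0 = 1 := by simp [qProd]

theorem qProd_succ (q : ℝ) (n : ℕ) : qProd q (n + 1) = qProd q n * (1 - q⁻¹ ^ (n + 1)) := by
  rw [qProd, qProd, Finset.prod_Icc_succ_top (by omega)]

theorem qProd_eq_prod_range (q : ℝ) (n : ℕ) :
    qProd q n = ∏ i ∈ Finset.range n, (1 - q⁻¹ ^ (i + 1)) := by
  induction n with
  | zero => simp [qProd]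
  | succ n ih => rw [qProd_succ, Finset.prod_range_succ, ih]

theorem one_quarter_add_le_qProd_two (n : ℕ) : 1 / 4 + (1 / 2 : ℝ) ^ (n + 2) ≤ qProd 2 (n + 1) := by
  induction n with
  | zero => norm_num [qProd_succ, qProd_zero]
  | succ n ih =>
    rw [qProd_succ]
    have h1 : (0 : ℝ) < (1 / 2) ^ n := by positivity
    have h2 : (1 / 2 : ℝ) ^ n ≤ 1 := pow_le_one₀ (by norm_num) (by norm_num)
    have h3 : ((2 : ℝ)⁻¹) ^ (n + 1 + 1) = 1 / 4 * (1 / 2) ^ n := by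
      rw [pow_add, pow_add, inv_eq_one_div]; ring
    have h4 : (1 / 2 : ℝ) ^ (n + 1 + 2) = 1 / 8 * (1 / 2) ^ n := by
      rw [pow_add, pow_add]; ring
    have h5 : (1 / 2 : ℝ) ^ (n + 2) = 1 / 4 * (1 / 2) ^ n := by
      rw [pow_add]; ring
    rw [h3, h4]
    rw [h5] at ih
    nlinarith

/-- A lower bound for `∏ (1 - q⁻ⁱ)` uniform in `q ≥ 2`. -/
theorem one_quarter_le_qProd {q : ℝ} (hq : 2 ≤ q) (n : ℕ) : 1 / 4 ≤ qProd q n := by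
  have h2 : 1 / 4 ≤ qProd 2 n := by
    cases n with
    | zero => norm_num [qProd_zero]
    | succ n =>
      refine le_trans ?_ (one_quarter_add_le_qProd_two n)
      have : (0 : ℝ) < (1 / 2) ^ (n + 2) := by positivity
      linarith
  refine h2.trans (Finset.prod_le_prod (fun i _ => ?_) fun i _ => ?_)
  · have : ((2 : ℝ)⁻¹) ^ i ≤ 1 := pow_le_one₀ (by norm_num) (by norm_num)
    linarith
  · have : q⁻¹ ^ i ≤ (2 : ℝ)⁻¹ ^ i :=
      pow_le_pow_left₀ (by positivity) (inv_anti₀ (by norm_num) hq) i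
    linarith

theorem qProd_pos {q : ℝ} (hq : 2 ≤ q) (n : ℕ) : 0 < qProd q n :=
  lt_of_lt_of_le (by norm_num) (one_quarter_le_qProd hq n)

theorem inv_qProd_le {q : ℝ} (hq : 2 ≤ q) (n : ℕ) : (qProd q n)⁻¹ ≤ 4 := by
  rw [inv_le_comm₀ (qProd_pos hq n) (by norm_num)]
  linarith [one_quarter_le_qProd hq n]

theorem prod_pow_sub_pow {q : ℝ} (hq : 2 ≤ q) (n : ℕ) :
    ∏ i : Fin n, (q ^ n - q ^ (i : ℕ)) = q ^ (n ^ 2) * qProd q n := by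
  have h0 : q ≠ 0 := by linarith
  have h1 : ∀ i ∈ Finset.range n, q ^ n - q ^ (n - 1 - i) = q ^ n * (1 - q⁻¹ ^ (i + 1)) := by
    intro i hi
    have hi' := Finset.mem_range.1 hi
    have h2 : q ^ n = q ^ (n - 1 - i) * q ^ (i + 1) := by rw [← pow_add]; congr 1; omega
    have h3 : q ^ (i + 1) * q⁻¹ ^ (i + 1) = 1 := by rw [← mul_pow, mul_inv_cancel₀ h0, one_pow]
    rw [h2]
    linear_combination (q ^ (n - 1 - i)) * h3
  rw [Fin.prod_univ_eq_prod_range (fun i => q ^ n - q ^ i), ← Finset.prod_range_reflect,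
    Finset.prod_congr rfl h1, Finset.prod_mul_distrib, ← qProd_eq_prod_range]
  simp [sq, pow_mul]

end QProd

section QSeries

open PowerSeries hiding X coeff

/-- Euler's series `∑ uⁿ / ((1 - q⁻¹) ⋯ (1 - q⁻ⁿ))`. -/
noncomputable def eulerSeries (q : ℝ) : PowerSeries ℂ :=
  PowerSeries.mk fun n => ((qProd q n)⁻¹ : ℂ)

/-- The expansion `∑ (-1)ⁿ q^(-n(n+1)/2) uⁿ / ((1 - q⁻¹) ⋯ (1 - q⁻ⁿ))` of
`∏_{r ≥ 1} (1 - u q⁻ʳ)`. -/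
noncomputable def eulerProdSeries (q : ℝ) : PowerSeries ℂ :=
  PowerSeries.mk fun n => ((-1) ^ n * ((q : ℂ)⁻¹) ^ (n * (n + 1) / 2) * (qProd q n : ℂ)⁻¹)

theorem inv_qProd_eq {q : ℝ} (hq : 2 ≤ q) (n : ℕ) :
    (qProd q n : ℂ)⁻¹ = (qProd q (n + 1) : ℂ)⁻¹ * (1 - (q : ℂ)⁻¹ ^ (n + 1)) := by
  have h1 : (qProd q n : ℂ) ≠ 0 := by exact_mod_cast (qProd_pos hq n).ne'
  have h2 : (qProd q (n + 1) : ℂ) ≠ 0 := by exact_mod_cast (qProd_pos hq (n + 1)).ne'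
  have h3 : (qProd q (n + 1) : ℂ) = qProd q n * (1 - (q : ℂ)⁻¹ ^ (n + 1)) := by
    rw [qProd_succ]; push_cast; rfl
  rw [inv_eq_iff_eq_inv, mul_inv, inv_inv, h3, mul_inv_cancel_right₀]
  rw [h3] at h2
  exact right_ne_zero_of_mul h2

theorem rescale_eulerSeries_s16 {q : ℝ} (hq : 2 ≤ q) :
    rescale ((q : ℂ)⁻¹) (eulerSeries q) = (1 - PowerSeries.X) * eulerSeries q := by
  ext n
  rw [sub_mul, one_mul, map_sub, coeff_rescale]
  cases n with
  | zero => simp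
  | succ n =>
    rw [coeff_succ_X_mul]
    simp only [eulerSeries, coeff_mk]
    rw [inv_qProd_eq hq n]
    ring

theorem eulerProdSeries_eq {q : ℝ} (hq : 2 ≤ q) :
    (1 - PowerSeries.X) * eulerProdSeries q = rescale (q : ℂ) (eulerProdSeries q) := by
  have hq0 : (q : ℂ) ≠ 0 := by exact_mod_cast (show q ≠ 0 by linarith)
  ext n
  rw [sub_mul, one_mul, map_sub, coeff_rescale]
  cases n with
  | zero => simp
  | succ n =>
    rw [coeff_succ_X_mul]
    simp only [eulerProdSeries, coeff_mk]
    have h5 : (n + 1) * (n + 1 + 1) / 2 = n * (n + 1) / 2 + (n + 1) := by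
      rw [show (n + 1) * (n + 1 + 1) = n * (n + 1) + (n + 1) * 2 by ring,
        Nat.add_mul_div_right _ _ (by norm_num)]
    rw [h5]
    rw [inv_qProd_eq hq n]
    have h7 : (q : ℂ) ^ (n + 1) * (q : ℂ)⁻¹ ^ (n + 1) = 1 := by
      rw [← mul_pow, mul_inv_cancel₀ hq0, one_pow]
    rw [pow_add (q : ℂ)⁻¹, pow_succ (-1 : ℂ) n]
    linear_combination ((-1) ^ n * (q : ℂ)⁻¹ ^ (n * (n + 1) / 2) * (qProd q (n + 1) : ℂ)⁻¹) * h7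

/-- Euler's identity: the two `q`-series are inverse to each other up to the factor `1 - u`. -/
theorem one_sub_X_mul_eulerSeries_mul {q : ℝ} (hq : 2 ≤ q) :
    (1 - PowerSeries.X) * eulerSeries q * eulerProdSeries q = 1 := by
  have hq0 : (q : ℂ) ≠ 0 := by exact_mod_cast (show q ≠ 0 by linarith)
  set P := (1 - PowerSeries.X) * eulerSeries q * eulerProdSeries q with hP
  have hresc : rescale (q : ℂ) P = P := by
    rw [hP, ← rescale_eulerSeries_s16 hq, map_mul, rescale_rescale, ← eulerProdSeries_eq hq,
      inv_mul_cancel₀ hq0, rescale_one, rescale_eulerSeries_s16 hq]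
    simp only [RingHom.id_apply]
    ring
  ext n
  cases n with
  | zero => simp [hP, eulerSeries, eulerProdSeries, qProd_zero, coeff_zero_eq_constantCoeff]
  | succ n =>
    have h := congrArg (PowerSeries.coeff (n + 1)) hresc
    rw [coeff_rescale] at h
    have hne : (q : ℂ) ^ (n + 1) ≠ 1 := by
      have : (1 : ℝ) < q ^ (n + 1) := one_lt_pow₀ (by linarith) (by omega)
      exact_mod_cast this.ne'
    have : ((q : ℂ) ^ (n + 1) - 1) * PowerSeries.coeff (n + 1) P = 0 := by rw [sub_mul, h]; ring
    rw [(mul_eq_zero.1 this).resolve_left (sub_ne_zero.2 hne)]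
    simp [PowerSeries.coeff_one]

end QSeries

section EigenvalueSeries

open PowerSeries hiding X coeff

variable {F : Type*} [Field F]

theorem trace_sq_of_isNilpotent_sub {a : F} {m : ℕ} {C : Module.End F (Fin m → F)}
    (hC : IsNilpotent (C - algebraMap F _ a)) :
    LinearMap.trace F _ (C * C) = m • a ^ 2 := by
  set N := C - algebraMap F (Module.End F (Fin m → F)) a with hN
  have hcomm : Commute N (N + algebraMap F _ (2 * a)) :=
    (Commute.refl N).add_right (Algebra.commutes _ _).symm
  have h1 : C * C = N * (N + algebraMap F _ (2 * a)) + algebraMap F _ (a ^ 2) := by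
    have : C = N + algebraMap F _ a := by rw [hN, sub_add_cancel]
    have hc : (algebraMap F (Module.End F (Fin m → F)) a) * N = N * algebraMap F _ a :=
      Algebra.commutes a N
    rw [this, mul_add, add_mul, add_mul, mul_add, hc, ← map_mul, two_mul, map_add, mul_add, sq]
    abel
  rw [h1, map_add, (LinearMap.isNilpotent_trace_of_isNilpotent
    (hcomm.isNilpotent_mul_right hC)).eq_zero, zero_add, Algebra.algebraMap_eq_smul_one, map_smul,
    LinearMap.trace_one]
  simp [mul_comm]

theorem isUnit_sub_of_isNilpotent_sub {a s : F} (hs : s ≠ a) {m : ℕ}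
    {C : Module.End F (Fin m → F)} (hC : IsNilpotent (C - algebraMap F _ a)) :
    IsUnit (C - algebraMap F _ s) := by
  have h1 : C - algebraMap F _ s = (C - algebraMap F _ a) + algebraMap F _ (a - s) := by
    rw [map_sub]; abel
  rw [h1]
  exact hC.isUnit_add_right_of_commute
    ((IsUnit.mk0 _ (sub_ne_zero.2 hs.symm)).map _) (Algebra.commutes _ _).symm

theorem FittingData.isUnit_toEnd_sub_iff {a : F} {n : ℕ} {p : ℕ × ℕ} (y : FittingData F a n p)
    (s : F) : IsUnit (y.toEnd - algebraMap F _ s) ↔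
      IsUnit (y.1.1 - algebraMap F _ s) ∧ IsUnit (y.2.1.1 - algebraMap F _ s) := by
  rw [FittingData.toEnd, conj_sub_algebraMap, isUnit_conj_iff, prodMap_sub_algebraMap,
    isUnit_prodMap_iff]

theorem FittingData.trace_sq {a : F} {n : ℕ} {p : ℕ × ℕ} (y : FittingData F a n p) :
    LinearMap.trace F _ (y.toEnd * y.toEnd) =
      LinearMap.trace F _ (y.1.1 * y.1.1) + p.2 • a ^ 2 := by
  have h1 : y.toEnd * y.toEnd = y.2.2.conj ((y.1.1 * y.1.1).prodMap (y.2.1.1 * y.2.1.1)) := by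
    rw [FittingData.toEnd]
    refine LinearMap.ext fun x => ?_
    simp [LinearEquiv.conj_apply]
  rw [h1, LinearMap.trace_conj', LinearMap.trace_prodMap', trace_sq_of_isNilpotent_sub y.2.1.2]

theorem cardGL_eq_card_units (n : ℕ) :
    cardGL F n = Nat.card (Matrix (Fin n) (Fin n) F)ˣ :=
  Nat.card_congr ((Matrix.GeneralLinearGroup.toLin (n := Fin n) (R := F)).trans
    (LinearMap.GeneralLinearGroup.generalLinearEquiv F (Fin n → F))).symm.toEquiv

variable [Fintype F]

open Classical in
/-- The weighted count of endomorphisms of `F ^ n` with no eigenvalue in `S`, where `T` has weight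
`ψ (Tr T²)`, normalised by the order of the general linear group. -/
noncomputable def avoidingSum (ψ : AddChar F ℂ) (S : Finset F) (n : ℕ) : ℂ :=
  (∑ T : Module.End F (Fin n → F) with ∀ s ∈ S, IsUnit (T - algebraMap F _ s),
    ψ (LinearMap.trace F _ (T * T))) / cardGL F n

/-- The generating function of `avoidingSum`. -/
noncomputable def avoidingSeries (ψ : AddChar F ℂ) (S : Finset F) : PowerSeries ℂ :=
  PowerSeries.mk (avoidingSum ψ S)

open Classical in
/-- The generating function of endomorphisms whose only eigenvalue is `a`. -/
noncomputable def unipotentSeries (a : F) : PowerSeries ℂ :=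
  PowerSeries.mk fun n => (Finset.card {C : Module.End F (Fin n → F) |
    IsNilpotent (C - algebraMap F _ a)} : ℂ) / cardGL F n

/-- Removing the eigenvalue `a` divides the generating function by a rescaled nilpotent series. -/
theorem avoidingSeries_eq_mul [DecidableEq F] (ψ : AddChar F ℂ) {S : Finset F} {a : F}
    (ha : a ∉ S) :
    avoidingSeries ψ S =
      avoidingSeries ψ (insert a S) * rescale (ψ (a ^ 2)) (unipotentSeries a) := by
  classical
  ext n
  rw [PowerSeries.coeff_mul]
  simp only [avoidingSeries, unipotentSeries, coeff_mk, coeff_rescale, avoidingSum]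
  have key := sum_end_eq_sum_fitting a n
    (fun T => if ∀ s ∈ S, IsUnit (T - algebraMap F _ s) then
      ψ (LinearMap.trace F _ (T * T)) else 0)
    (fun m B => if ∀ s ∈ S, IsUnit (B - algebraMap F _ s) then
      ψ (LinearMap.trace F _ (B * B)) else 0)
    (fun m _ => ψ (a ^ 2) ^ m) (fun p y => by
      have : (∀ s ∈ S, IsUnit (y.toEnd - algebraMap F _ s)) ↔
          ∀ s ∈ S, IsUnit (y.1.1 - algebraMap F _ s) := by
        refine forall₂_congr fun s hs => ?_
        rw [y.isUnit_toEnd_sub_iff]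
        exact and_iff_left (isUnit_sub_of_isNilpotent_sub (fun h => ha (by rwa [← h])) y.2.1.2)
      simp only [this, y.trace_sq, AddChar.map_add_eq_mul, AddChar.map_nsmul_eq_pow, ite_mul,
        zero_mul])
  rw [Finset.sum_filter]
  refine Eq.trans (by congr!) (key.trans (Finset.sum_congr rfl fun p _ => ?_))
  congr 1
  · rw [← Finset.sum_filter, Finset.filter_filter]
    congr 2
    ext B
    simp
  · rw [Finset.sum_const, nsmul_eq_mul]
    ring

theorem card_eq_qProd {q : ℕ} (hq : Fintype.card F = q) (n : ℕ) :
    (cardGL F n : ℝ) = (q : ℝ) ^ (n ^ 2) * qProd q n := by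
  have hq2 : 2 ≤ q := hq ▸ Fintype.one_lt_card
  rw [cardGL_eq_card_units, Matrix.card_GL_field, ← prod_pow_sub_pow (by exact_mod_cast hq2),
    Nat.cast_prod]
  refine Finset.prod_congr rfl fun i _ => ?_
  rw [Nat.cast_sub (Nat.pow_le_pow_right Fintype.card_pos i.2.le), hq]
  push_cast
  rfl

theorem card_end (n : ℕ) : Fintype.card (Module.End F (Fin n → F)) = Fintype.card F ^ (n ^ 2) := by
  rw [← Fintype.card_congr (Matrix.toLin' (R := F) (m := Fin n) (n := Fin n)).toEquiv]
  rw [Fintype.card_congr Matrix.of.symm]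
  simp [sq, pow_mul]

theorem avoidingSeries_zero_empty {q : ℕ} (hq : Fintype.card F = q) :
    avoidingSeries (0 : AddChar F ℂ) ∅ = eulerSeries q := by
  ext n
  have hq2 : 2 ≤ q := hq ▸ Fintype.one_lt_card
  have h1 : (cardGL F n : ℂ) = (q : ℂ) ^ (n ^ 2) * qProd q n := by
    exact_mod_cast congrArg (Complex.ofReal) (card_eq_qProd hq n)
  have h2 : (q : ℂ) ≠ 0 := by exact_mod_cast (by omega : q ≠ 0)
  simp only [avoidingSeries, avoidingSum, eulerSeries, coeff_mk, h1]
  simp only [Finset.notMem_empty, false_implies, implies_true, Finset.filter_true,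
    AddChar.zero_apply, Finset.sum_const, Finset.card_univ, card_end, hq]
  simp only [nsmul_eq_mul, Nat.cast_pow, mul_one]
  field_simp

theorem avoidingSeries_zero_singleton (a : F) :
    avoidingSeries (0 : AddChar F ℂ) {a} = PowerSeries.mk 1 := by
  classical
  ext n
  simp only [avoidingSeries, avoidingSum, coeff_mk, Finset.mem_singleton, forall_eq,
    AddChar.zero_apply, Finset.sum_const, nsmul_eq_mul, mul_one, Pi.one_apply]
  have : Finset.card {T : Module.End F (Fin n → F) | IsUnit (T - algebraMap F _ a)} =
      cardGL F n := by
    rw [cardGL, ← Nat.card_congr (LinearMap.GeneralLinearGroup.generalLinearEquiv F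
      (Fin n → F)).toEquiv, ← Fintype.card_subtype, ← Nat.card_eq_fintype_card]
    refine Nat.card_congr ?_
    exact ((Equiv.subRight (algebraMap F (Module.End F (Fin n → F)) a)).subtypeEquiv
      (q := IsUnit) (fun _ => Iff.rfl)).trans
      ⟨fun u => u.2.unit, fun u => ⟨u, u.isUnit⟩, fun u => rfl, fun u => by ext; rfl⟩
  rw [this]
  exact div_self (by exact_mod_cast (cardGL_pos n).ne')

theorem unipotentSeries_mul_eulerProdSeries {q : ℕ} (hq : Fintype.card F = q) (a : F) :
    unipotentSeries a * eulerProdSeries q = 1 := by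
  classical
  have hq2 : (2 : ℝ) ≤ q := by exact_mod_cast hq ▸ Fintype.one_lt_card
  have h := avoidingSeries_eq_mul (0 : AddChar F ℂ) (Finset.notMem_empty a)
  rw [avoidingSeries_zero_empty hq, insert_empty_eq, avoidingSeries_zero_singleton,
    AddChar.zero_apply, rescale_one, RingHom.id_apply] at h
  have h2 : (1 - PowerSeries.X) * eulerSeries q = unipotentSeries a := by
    rw [h, ← mul_assoc, mul_comm (1 - PowerSeries.X), PowerSeries.mk_one_mul_one_sub_eq_one,
      one_mul]
  rw [← h2, one_sub_X_mul_eulerSeries_mul hq2]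

/-- The generating function of endomorphisms without eigenvalues in `S`. -/
theorem avoidingSeries_eq_prod {q : ℕ} (hq : Fintype.card F = q) (ψ : AddChar F ℂ)
    (S : Finset F) :
    avoidingSeries ψ S =
      avoidingSeries ψ ∅ * ∏ a ∈ S, rescale (ψ (a ^ 2)) (eulerProdSeries q) := by
  classical
  induction S using Finset.induction_on with
  | empty => simp
  | insert a S ha ih =>
    rw [Finset.prod_insert ha, mul_left_comm, ← ih, avoidingSeries_eq_mul ψ ha, mul_left_comm,
      ← map_mul, mul_comm (eulerProdSeries (q : ℝ)), unipotentSeries_mul_eulerProdSeries hq,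
      map_one, mul_one]

/-- The generating function of the proportion of eigenvalue-free matrices. -/
theorem avoidingSeries_zero_univ {q : ℕ} (hq : Fintype.card F = q) :
    avoidingSeries (0 : AddChar F ℂ) Finset.univ =
      PowerSeries.mk 1 * eulerProdSeries q ^ (q - 1) := by
  have hq2 : 2 ≤ q := hq ▸ Fintype.one_lt_card
  have hq2' : (2 : ℝ) ≤ q := by exact_mod_cast hq2
  rw [avoidingSeries_eq_prod hq, avoidingSeries_zero_empty hq]
  simp only [AddChar.zero_apply, rescale_one, RingHom.id_apply, Finset.prod_const,
    Finset.card_univ, hq]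
  obtain ⟨m, rfl⟩ : ∃ m, q = m + 1 := ⟨q - 1, by omega⟩
  have h := one_sub_X_mul_eulerSeries_mul hq2'
  have h3 : eulerSeries ((m + 1 : ℕ) : ℝ) * eulerProdSeries ((m + 1 : ℕ) : ℝ) =
      PowerSeries.mk 1 := by
    rw [← one_mul (eulerSeries _ * _), ← PowerSeries.mk_one_mul_one_sub_eq_one ℂ,
      mul_assoc (PowerSeries.mk 1), ← mul_assoc (1 - PowerSeries.X), h, mul_one]
  rw [pow_succ', ← mul_assoc, h3, Nat.add_sub_cancel]

end EigenvalueSeries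

section GaussSum

theorem card_matrix_fin (R : Type*) [Fintype R] (n : ℕ) :
    Fintype.card (Matrix (Fin n) (Fin n) R) = Fintype.card R ^ (n ^ 2) := by
  rw [← Nat.card_eq_fintype_card, ← Nat.card_eq_fintype_card, Matrix]
  simp [sq, pow_mul]

variable {F : Type*} [Field F]

theorem trace_add_mul_add {n : ℕ} (A B : Matrix (Fin n) (Fin n) F) :
    ((A + B) * (A + B)).trace = (A * A).trace + (B * B).trace + 2 * (A * B).trace := by
  rw [add_mul, mul_add, mul_add]
  simp only [Matrix.trace_add]
  rw [Matrix.trace_mul_comm B A]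
  ring

variable [Fintype F]

theorem sum_addChar_two_mul_trace (h2 : (2 : F) ≠ 0) {ψ : AddChar F ℂ} (hψ : ψ ≠ 0) {n : ℕ}
    (C : Matrix (Fin n) (Fin n) F) (hC : C ≠ 0) :
    ∑ B : Matrix (Fin n) (Fin n) F, ψ (2 * (C * B).trace) = 0 := by
  obtain ⟨x, hx⟩ := AddChar.ne_zero_iff.1 hψ
  obtain ⟨i, j, hij⟩ : ∃ i j, C i j ≠ 0 := by
    by_contra! h
    exact hC (Matrix.ext h)
  let f : Matrix (Fin n) (Fin n) F →+ F :=
    { toFun := fun B => 2 * (C * B).trace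
      map_zero' := by simp
      map_add' := fun A B => by rw [mul_add, Matrix.trace_add, mul_add] }
  refine (AddChar.sum_eq_zero_iff_ne_zero (ψ := ψ.compAddMonoidHom f)).2 ?_
  refine AddChar.ne_zero_iff.2 ⟨Matrix.single j i (x / (2 * C i j)), ?_⟩
  have : f (Matrix.single j i (x / (2 * C i j))) = x := by
    change 2 * (C * Matrix.single j i (x / (2 * C i j))).trace = x
    rw [Matrix.trace_mul_single]
    simp
    field_simp
  rw [AddChar.compAddMonoidHom_apply, this]
  exact hx

theorem norm_sum_addChar_trace_sq_le {ψ : AddChar F ℂ} (hψ : ψ ≠ 0) (n : ℕ) :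
    ‖∑ A : Matrix (Fin n) (Fin n) F, ψ (A * A).trace‖ ^ 2 ≤ (Fintype.card F : ℝ) ^ (n ^ 2) := by
  classical
  rcases eq_or_ne (2 : F) 0 with h2 | h2
  · rcases Nat.eq_zero_or_pos n with rfl | hn
    · simp [card_matrix_fin]
    let f : Matrix (Fin n) (Fin n) F →+ F :=
      { toFun := fun A => (A * A).trace
        map_zero' := by simp
        map_add' := fun A B => by rw [trace_add_mul_add, h2, zero_mul, add_zero] }
    obtain ⟨x, hx⟩ := AddChar.ne_zero_iff.1 hψ
    have : CharP F 2 := CharTwo.of_one_ne_zero_of_two_eq_zero one_ne_zero h2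
    obtain ⟨y, hy⟩ := (bijective_frobenius F 2).2 x
    have h0 : ∑ A : Matrix (Fin n) (Fin n) F, ψ (A * A).trace = 0 := by
      refine (AddChar.sum_eq_zero_iff_ne_zero (ψ := ψ.compAddMonoidHom f)).2 ?_
      refine AddChar.ne_zero_iff.2 ⟨Matrix.single ⟨0, hn⟩ ⟨0, hn⟩ y, ?_⟩
      have : f (Matrix.single ⟨0, hn⟩ ⟨0, hn⟩ y) = x := by
        change (Matrix.single (⟨0, hn⟩ : Fin n) (⟨0, hn⟩ : Fin n) y *
          Matrix.single (⟨0, hn⟩ : Fin n) (⟨0, hn⟩ : Fin n) y).trace = x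
        rw [Matrix.single_mul_single_same, Matrix.trace_single_eq_same, ← hy, frobenius_def, sq]
      rw [AddChar.compAddMonoidHom_apply, this]
      exact hx
    rw [h0]
    simp
  · set S := ∑ A : Matrix (Fin n) (Fin n) F, ψ (A * A).trace with hS
    have key : S * (starRingEnd ℂ) S = (Fintype.card F : ℂ) ^ (n ^ 2) := by
      calc S * (starRingEnd ℂ) S
          = ∑ B : Matrix (Fin n) (Fin n) F, ∑ C : Matrix (Fin n) (Fin n) F,
            ψ (C * C).trace * ψ (2 * (C * B).trace) := by
            rw [hS, map_sum, Finset.mul_sum]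
            refine Finset.sum_congr rfl fun B _ => ?_
            rw [Finset.sum_mul]
            refine (Fintype.sum_equiv (Equiv.addRight B) _ _ fun C => ?_).symm
            rw [Equiv.coe_addRight, trace_add_mul_add, ← AddChar.map_neg_eq_conj,
              ← AddChar.map_add_eq_mul, ← AddChar.map_add_eq_mul]
            congr 1
            ring
        _ = ∑ C : Matrix (Fin n) (Fin n) F, ψ (C * C).trace *
            ∑ B : Matrix (Fin n) (Fin n) F, ψ (2 * (C * B).trace) := by
            rw [Finset.sum_comm]
            simp only [Finset.mul_sum]
        _ = (Fintype.card F : ℂ) ^ (n ^ 2) := by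
            rw [Finset.sum_eq_single 0]
            · simp [card_matrix_fin]
            · intro C _ hC
              rw [sum_addChar_two_mul_trace h2 hψ C hC, mul_zero]
            · simp
    rw [Complex.mul_conj, Complex.normSq_eq_norm_sq] at key
    exact (by exact_mod_cast key : ‖S‖ ^ 2 = (Fintype.card F : ℝ) ^ (n ^ 2)).le

theorem sum_end_eq_sum_matrix (ψ : AddChar F ℂ) (n : ℕ) :
    ∑ T : Module.End F (Fin n → F), ψ (LinearMap.trace F _ (T * T)) =
      ∑ A : Matrix (Fin n) (Fin n) F, ψ (A * A).trace := by
  refine (Fintype.sum_equiv Matrix.toLinAlgEquiv'.toEquiv _ _ fun A => ?_).symm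
  rw [← Matrix.trace_toLin'_eq, Matrix.toLin'_mul]
  rfl

theorem norm_avoidingSum_empty_le {q : ℕ} (hq : Fintype.card F = q) {ψ : AddChar F ℂ} (hψ : ψ ≠ 0)
    (n : ℕ) : ‖avoidingSum ψ ∅ n‖ ≤ (q : ℝ) ^ (-((n : ℝ) ^ 2) / 2) * (qProd q n)⁻¹ := by
  have hq2 : 2 ≤ q := hq ▸ Fintype.one_lt_card
  have hq0 : (0 : ℝ) < q := by positivity
  have hP : 0 < qProd (q : ℝ) n := qProd_pos (by exact_mod_cast hq2) n
  have h1 : ‖∑ A : Matrix (Fin n) (Fin n) F, ψ (A * A).trace‖ ≤ (q : ℝ) ^ ((n : ℝ) ^ 2 / 2) := by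
    refine le_of_sq_le_sq ?_ (by positivity)
    refine (norm_sum_addChar_trace_sq_le hψ n).trans_eq ?_
    rw [hq, ← Real.rpow_natCast _ 2, ← Real.rpow_mul hq0.le, ← Real.rpow_natCast]
    push_cast
    congr 1
    ring
  rw [avoidingSum]
  simp only [Finset.notMem_empty, IsEmpty.forall_iff, implies_true, Finset.filter_true]
  rw [sum_end_eq_sum_matrix, norm_div, Complex.norm_natCast, card_eq_qProd hq, div_eq_mul_inv,
    mul_inv, ← mul_assoc]
  refine mul_le_mul_of_nonneg_right ?_ (by positivity)
  calc _ ≤ (q : ℝ) ^ ((n : ℝ) ^ 2 / 2) * ((q : ℝ) ^ (n ^ 2))⁻¹ := by gcongr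
    _ = _ := by
      rw [← Real.rpow_natCast _ (n ^ 2), ← Real.rpow_neg hq0.le, ← Real.rpow_add hq0]
      push_cast
      congr 1
      ring

end GaussSum

section CharacterSum

variable {F : Type*} [Field F]

theorem forall_eval_charpoly_ne_zero_iff {n : ℕ} (A : Matrix (Fin n) (Fin n) F) :
    (∀ t : F, A.charpoly.eval t ≠ 0) ↔
      ∀ s : F, IsUnit (Matrix.toLinAlgEquiv' A - algebraMap F (Module.End F (Fin n → F)) s) := by
  refine forall_congr' fun t => ?_
  have h := (Matrix.mem_spectrum_iff_isRoot_charpoly (A := A) (r := t)).not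
  rw [spectrum.mem_iff, not_not, Polynomial.IsRoot.def] at h
  rw [Ne, ← h, ← AlgEquiv.commutes Matrix.toLinAlgEquiv' t, ← map_sub,
    MulEquiv.isUnit_map, ← neg_sub, IsUnit.neg_iff]

open Classical in
theorem natCard_units_eq_card_filter [Fintype F] (n : ℕ) (k : F) :
    Nat.card {A : (Matrix (Fin n) (Fin n) F)ˣ //
      (∀ t : F, ((A.val : Matrix (Fin n) (Fin n) F).charpoly).eval t ≠ 0) ∧
      (A.val * A.val).trace = k} =
    Finset.card {T : Module.End F (Fin n → F) |
      (∀ s ∈ Finset.univ, IsUnit (T - algebraMap F _ s)) ∧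
      LinearMap.trace F _ (T * T) - k = 0} := by
  rw [← Fintype.card_subtype, ← Nat.card_eq_fintype_card]
  have htr (A : Matrix (Fin n) (Fin n) F) : LinearMap.trace F _
      (Matrix.toLinAlgEquiv' A * Matrix.toLinAlgEquiv' A) = (A * A).trace := by
    rw [← map_mul]
    exact Matrix.trace_toLin'_eq _
  refine Nat.card_eq_of_bijective (fun A => ⟨Matrix.toLinAlgEquiv' A.1.val, ?_, ?_⟩) ⟨?_, ?_⟩
  · exact fun s _ => (forall_eval_charpoly_ne_zero_iff _).1 A.2.1 s
  · rw [htr, A.2.2, sub_self]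
  · intro A B h
    exact Subtype.ext (Units.ext (Matrix.toLinAlgEquiv'.injective (congrArg Subtype.val h)))
  · rintro ⟨T, h1, h2⟩
    obtain ⟨A, rfl⟩ := Matrix.toLinAlgEquiv'.surjective T
    have hA : IsUnit A := by
      simpa [MulEquiv.isUnit_map] using h1 0 (Finset.mem_univ _)
    obtain ⟨u, rfl⟩ := hA
    rw [htr, sub_eq_zero] at h2
    exact ⟨⟨u, (forall_eval_charpoly_ne_zero_iff _).2 fun s => h1 s (Finset.mem_univ _), h2⟩, rfl⟩

theorem betaGL_eq_sum [Fintype F] {q : ℕ} (hq : Fintype.card F = q) (n : ℕ) (k : F) :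
    (betaGL F n k : ℂ) = (q : ℂ)⁻¹ * ∑ ψ : AddChar F ℂ, ψ (-k) * avoidingSum ψ Finset.univ n := by
  classical
  have hq0 : (q : ℂ) ≠ 0 := by
    rw [← hq]
    exact_mod_cast Fintype.card_ne_zero
  have h : ∑ ψ : AddChar F ℂ, ψ (-k) * avoidingSum ψ Finset.univ n =
      (q * (Finset.card {T : Module.End F (Fin n → F) |
        (∀ s ∈ Finset.univ, IsUnit (T - algebraMap F _ s)) ∧
        LinearMap.trace F _ (T * T) - k = 0} : ℂ)) / cardGL F n := by
    simp only [avoidingSum, mul_div_assoc', ← Finset.sum_div, Finset.mul_sum]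
    congr 1
    rw [Finset.sum_comm]
    simp only [← AddChar.map_add_eq_mul, AddChar.sum_apply_eq_ite, neg_add_eq_sub, hq]
    rw [← Finset.sum_filter, Finset.filter_filter, Finset.sum_const, nsmul_eq_mul, mul_comm]
  rw [h, betaGL, natCard_units_eq_card_filter, cardGL_eq_card_units]
  push_cast
  field_simp

end CharacterSum

section CoeffBound

open PowerSeries hiding X coeff

/-- The power series `f` converges absolutely at radius `t`, with `∑ |fⱼ| tʲ ≤ B`. -/
def CoeffBound (f : PowerSeries ℂ) (t B : ℝ) : Prop :=
  ∀ N, ∑ j ∈ Finset.range N, ‖PowerSeries.coeff j f‖ * t ^ j ≤ B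

namespace CoeffBound

variable {f g : PowerSeries ℂ} {t B C : ℝ}

theorem nonneg (hf : CoeffBound f t B) : 0 ≤ B := by
  simpa using hf 0

theorem norm_coeff_mul_pow_le (hf : CoeffBound f t B) (ht : 0 ≤ t) (n : ℕ) :
    ‖PowerSeries.coeff n f‖ * t ^ n ≤ B :=
  (Finset.single_le_sum (f := fun j => ‖PowerSeries.coeff j f‖ * t ^ j)
    (fun _ _ => by positivity) (Finset.self_mem_range_succ n)).trans (hf (n + 1))

theorem mul (hf : CoeffBound f t B) (hg : CoeffBound g t C) (ht : 0 ≤ t) :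
    CoeffBound (f * g) t (B * C) := by
  intro N
  set a : ℕ → ℝ := fun j => ‖PowerSeries.coeff j f‖ * t ^ j
  set b : ℕ → ℝ := fun j => ‖PowerSeries.coeff j g‖ * t ^ j
  have ha j : 0 ≤ a j := by positivity
  have hb j : 0 ≤ b j := by positivity
  calc ∑ n ∈ Finset.range N, ‖PowerSeries.coeff n (f * g)‖ * t ^ n
      ≤ ∑ n ∈ Finset.range N, ∑ p ∈ Finset.HasAntidiagonal.antidiagonal n, a p.1 * b p.2 := by
        refine Finset.sum_le_sum fun n _ => ?_
        rw [PowerSeries.coeff_mul]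
        refine (mul_le_mul_of_nonneg_right (norm_sum_le _ _) (by positivity)).trans_eq ?_
        rw [Finset.sum_mul]
        refine Finset.sum_congr rfl fun p hp => ?_
        rw [← Finset.HasAntidiagonal.mem_antidiagonal.1 hp, norm_mul, pow_add]
        ring
    _ = ∑ x ∈ (Finset.range N).sigma fun n => Finset.HasAntidiagonal.antidiagonal n,
        a x.2.1 * b x.2.2 := Finset.sum_sigma' _ _ _
    _ = ∑ p ∈ ((Finset.range N).sigma fun n => Finset.HasAntidiagonal.antidiagonal n).image
        Sigma.snd, a p.1 * b p.2 := by
        rw [Finset.sum_image]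
        rintro ⟨n, p⟩ hx ⟨m, p'⟩ hy h
        simp only [Finset.coe_sigma, Set.mem_sigma_iff, Finset.mem_coe,
          Finset.HasAntidiagonal.mem_antidiagonal] at hx hy h
        obtain rfl : p = p' := h
        obtain rfl : n = m := hx.2.symm.trans hy.2
        rfl
    _ ≤ ∑ p ∈ Finset.range N ×ˢ Finset.range N, a p.1 * b p.2 := by
        refine Finset.sum_le_sum_of_subset_of_nonneg ?_ fun p _ _ => mul_nonneg (ha _) (hb _)
        intro p hp
        simp only [Finset.mem_image, Finset.mem_sigma, Finset.mem_range,
          Finset.HasAntidiagonal.mem_antidiagonal] at hp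
        obtain ⟨⟨n, p⟩, ⟨h1, h2⟩, rfl⟩ := hp
        simp only [Finset.mem_product, Finset.mem_range] at h1 h2 ⊢
        omega
    _ = (∑ j ∈ Finset.range N, a j) * ∑ j ∈ Finset.range N, b j := by
        rw [Finset.sum_product, Finset.sum_mul_sum]
    _ ≤ B * C := by
        have := hf.nonneg
        exact mul_le_mul (hf N) (hg N) (Finset.sum_nonneg fun j _ => hb j) this

theorem one : CoeffBound 1 t 1 := by
  intro N
  simp only [PowerSeries.coeff_one]
  rcases N with _ | N
  · simp
  · rw [Finset.sum_range_succ']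
    simp

theorem prod {ι : Type*} {s : Finset ι} {f : ι → PowerSeries ℂ} (ht : 0 ≤ t)
    (hf : ∀ i ∈ s, CoeffBound (f i) t B) : CoeffBound (∏ i ∈ s, f i) t (B ^ s.card) := by
  classical
  induction s using Finset.induction_on with
  | empty => simpa using one
  | insert i s hi ih =>
    rw [Finset.prod_insert hi, Finset.card_insert_of_notMem hi, pow_succ']
    exact (hf i (Finset.mem_insert_self i s)).mul
      (ih fun j hj => hf j (Finset.mem_insert_of_mem hj)) ht

theorem pow (hf : CoeffBound f t B) (ht : 0 ≤ t) (k : ℕ) : CoeffBound (f ^ k) t (B ^ k) := by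
  simpa using prod (s := Finset.range k) (f := fun _ => f) ht fun _ _ => hf

theorem rescale (hf : CoeffBound f t B) {z : ℂ} (hz : ‖z‖ = 1) :
    CoeffBound (PowerSeries.rescale z f) t B := by
  intro N
  simpa [PowerSeries.coeff_rescale, hz] using hf N

theorem summable_norm (hf : CoeffBound f t B) (ht : 1 ≤ t) :
    Summable fun j => ‖PowerSeries.coeff j f‖ := by
  refine summable_of_sum_range_le (c := B) (fun _ => norm_nonneg _) fun N => ?_
  refine (Finset.sum_le_sum fun j _ => ?_).trans (hf N)
  exact le_mul_of_one_le_right (norm_nonneg _) (one_le_pow₀ ht)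

end CoeffBound

theorem coeff_mul_mk_one (f : PowerSeries ℂ) (n : ℕ) :
    PowerSeries.coeff n (PowerSeries.mk 1 * f) =
      ∑ j ∈ Finset.range (n + 1), PowerSeries.coeff j f := by
  rw [mul_comm, PowerSeries.coeff_mul,
    Finset.Nat.sum_antidiagonal_eq_sum_range_succ_mk]
  simp

theorem norm_partialSum_sub_le {f : PowerSeries ℂ} {t B : ℝ} (hf : CoeffBound f t B) (ht : 1 ≤ t)
    {α : ℂ} (hα : Tendsto (fun n => PowerSeries.coeff n (PowerSeries.mk 1 * f)) atTop (nhds α))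
    (n : ℕ) : ‖PowerSeries.coeff n (PowerSeries.mk 1 * f) - α‖ ≤ B / t ^ n := by
  have ht0 : 0 < t := by linarith
  have h : Tendsto (fun N => ‖PowerSeries.coeff n (PowerSeries.mk 1 * f) -
      PowerSeries.coeff N (PowerSeries.mk 1 * f)‖) atTop
      (nhds ‖PowerSeries.coeff n (PowerSeries.mk 1 * f) - α‖) :=
    (tendsto_const_nhds.sub hα).norm
  refine le_of_tendsto h (eventually_atTop.2 ⟨n, fun N hN => ?_⟩)
  rw [norm_sub_rev, coeff_mul_mk_one, coeff_mul_mk_one,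
    ← Finset.sum_Ico_eq_sub _ (Nat.succ_le_succ hN), le_div_iff₀ (by positivity)]
  calc _ ≤ (∑ j ∈ Finset.Ico (n + 1) (N + 1), ‖PowerSeries.coeff j f‖) * t ^ n := by
        gcongr
        exact norm_sum_le _ _
    _ ≤ ∑ j ∈ Finset.Ico (n + 1) (N + 1), ‖PowerSeries.coeff j f‖ * t ^ j := by
        rw [Finset.sum_mul]
        refine Finset.sum_le_sum fun j hj => ?_
        have : n ≤ j := Nat.le_of_succ_le (Finset.mem_Ico.1 hj).1
        gcongr
    _ ≤ ∑ j ∈ Finset.range (N + 1), ‖PowerSeries.coeff j f‖ * t ^ j := by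
        refine Finset.sum_le_sum_of_subset_of_nonneg (fun j hj => ?_) fun _ _ _ => by positivity
        exact Finset.mem_range.2 (Finset.mem_Ico.1 hj).2
    _ ≤ B := hf _

/-- If `∑ fⱼ` converges absolutely and `gₙ → α`, then the coefficients of `f * g` tend to
`(∑ fⱼ) α`. -/
theorem tendsto_coeff_mul {f g : PowerSeries ℂ} (hf : Summable fun j => ‖PowerSeries.coeff j f‖)
    {α : ℂ} (hg : Tendsto (fun n => PowerSeries.coeff n g) atTop (nhds α)) :
    Tendsto (fun n => PowerSeries.coeff n (f * g)) atTop
      (nhds ((∑' j, PowerSeries.coeff j f) * α)) := by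
  obtain ⟨K, hK⟩ := (Metric.isBounded_range_of_tendsto _ hg).exists_norm_le
  have hK' (j : ℕ) : ‖PowerSeries.coeff j g‖ ≤ K := hK _ ⟨j, rfl⟩
  have hK0 : 0 ≤ K := (norm_nonneg _).trans (hK' 0)
  have h1 (n : ℕ) : PowerSeries.coeff n (f * g) = ∑' j, if j ∈ Finset.range (n + 1) then
      PowerSeries.coeff j f * PowerSeries.coeff (n - j) g else 0 := by
    rw [PowerSeries.coeff_mul, Finset.Nat.sum_antidiagonal_eq_sum_range_succ_mk,
      tsum_eq_sum (s := Finset.range (n + 1)) fun j hj => if_neg hj]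
    exact Finset.sum_congr rfl fun j hj => (if_pos hj).symm
  rw [← tsum_mul_right]
  simp only [h1]
  refine tendsto_tsum_of_dominated_convergence (hf.mul_right K) (fun j => ?_)
    (Eventually.of_forall fun n j => ?_)
  · have h2 : Tendsto (fun n => PowerSeries.coeff j f * PowerSeries.coeff (n - j) g) atTop
        (nhds (PowerSeries.coeff j f * α)) :=
      (hg.comp (tendsto_sub_atTop_nat j)).const_mul _
    refine h2.congr' (eventually_atTop.2 ⟨j, fun n hn => ?_⟩)
    exact (if_pos (Finset.mem_range.2 (Nat.lt_succ_of_le hn))).symm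
  · split_ifs
    · rw [norm_mul]
      gcongr
      exact hK' _
    · rw [norm_zero]
      positivity

end CoeffBound

section Limit

open PowerSeries hiding X coeff

theorem eulerProdSeries_mul_eulerSeries {q : ℝ} (hq : 2 ≤ q) :
    eulerProdSeries q * eulerSeries q = PowerSeries.mk 1 := by
  have h := one_sub_X_mul_eulerSeries_mul hq
  have h1 : PowerSeries.mk (1 : ℕ → ℂ) * (1 - PowerSeries.X) = 1 :=
    PowerSeries.mk_one_mul_one_sub_eq_one ℂ
  calc eulerProdSeries q * eulerSeries q
      = PowerSeries.mk 1 * (1 - PowerSeries.X) * (eulerProdSeries q * eulerSeries q) := by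
        rw [h1, one_mul]
    _ = PowerSeries.mk 1 * ((1 - PowerSeries.X) * eulerSeries q * eulerProdSeries q) := by ring
    _ = PowerSeries.mk 1 := by rw [h, mul_one]

variable {q c t B : ℝ}

theorem tsum_coeff_eulerProdSeries (hq : 2 ≤ q) (hc : Tendsto (qProd q) atTop (nhds c))
    (ht : 1 ≤ t) (hB : CoeffBound (eulerProdSeries q) t B) :
    ∑' j, PowerSeries.coeff j (eulerProdSeries q) = (c : ℂ) := by
  have hc0 : (c : ℂ) ≠ 0 := by
    have : 1 / 4 ≤ c := ge_of_tendsto' hc fun n => one_quarter_le_qProd hq n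
    exact_mod_cast (by linarith : 0 < c).ne'
  have hg : Tendsto (fun n => PowerSeries.coeff n (eulerSeries q)) atTop (nhds (c : ℂ)⁻¹) := by
    simp only [eulerSeries, coeff_mk]
    exact ((Complex.continuous_ofReal.tendsto c).comp hc).inv₀ hc0
  have h := tendsto_coeff_mul (hB.summable_norm ht) hg
  rw [eulerProdSeries_mul_eulerSeries hq] at h
  simp only [coeff_mk, Pi.one_apply] at h
  exact (mul_inv_eq_one₀ hc0).1 (tendsto_nhds_unique h tendsto_const_nhds)

theorem tendsto_coeff_eulerProdSeries_pow (hq : 2 ≤ q) (hc : Tendsto (qProd q) atTop (nhds c))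
    (ht : 1 ≤ t) (hB : CoeffBound (eulerProdSeries q) t B) (k : ℕ) :
    Tendsto (fun n => PowerSeries.coeff n (PowerSeries.mk 1 * eulerProdSeries q ^ k)) atTop
      (nhds ((c : ℂ) ^ k)) := by
  induction k with
  | zero => simp
  | succ k ih =>
    have h := tendsto_coeff_mul (hB.summable_norm ht) ih
    rw [tsum_coeff_eulerProdSeries hq hc ht hB] at h
    rw [pow_succ' (c : ℂ)]
    refine h.congr fun n => ?_
    rw [pow_succ', mul_left_comm]

variable {F : Type*} [Field F] [Fintype F]

/-- The deviation of `betaGL` from its limit in terms of majorants of the series involved. -/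
theorem abs_betaGL_sub_le {q : ℕ} (hq : Fintype.card F = q)
    (hc : Tendsto (qProd q) atTop (nhds c)) (ht : 1 ≤ t) {M D : ℝ} (hM1 : 1 ≤ M) (hD1 : 1 ≤ D)
    (hM : ∀ ψ : AddChar F ℂ, ψ ≠ 0 → CoeffBound (avoidingSeries ψ ∅) t M)
    (hD : CoeffBound (eulerProdSeries q) t D) (n : ℕ) (k : F) :
    |1 / (q : ℝ) * c ^ (q - 1) - betaGL F n k| ≤ M * D ^ q / t ^ n := by
  classical
  have hq2 : 2 ≤ q := hq ▸ Fintype.one_lt_card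
  have hq2' : (2 : ℝ) ≤ q := by exact_mod_cast hq2
  have hq0 : (0 : ℝ) < q := by linarith
  have ht0 : 0 < t := by linarith
  set lim : AddChar F ℂ → ℂ := fun ψ => if ψ = 0 then (c : ℂ) ^ (q - 1) else 0 with hlim
  have hbound (ψ : AddChar F ℂ) :
      ‖avoidingSum ψ Finset.univ n - lim ψ‖ ≤ M * D ^ q / t ^ n := by
    have hcoeff : avoidingSum ψ Finset.univ n =
      PowerSeries.coeff n (avoidingSeries ψ Finset.univ) := by rw [avoidingSeries, coeff_mk]
    rcases eq_or_ne ψ 0 with rfl | hψ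
    · rw [show lim 0 = (c : ℂ) ^ (q - 1) from if_pos rfl, hcoeff, avoidingSeries_zero_univ hq]
      refine (norm_partialSum_sub_le (hD.pow ht0.le (q - 1)) ht
        (tendsto_coeff_eulerProdSeries_pow hq2' hc ht hD (q - 1)) n).trans ?_
      gcongr
      calc D ^ (q - 1) ≤ D ^ q := pow_le_pow_right₀ hD1 (Nat.sub_le q 1)
        _ ≤ M * D ^ q := le_mul_of_one_le_left (by positivity) hM1
    · rw [show lim ψ = 0 from if_neg hψ, sub_zero, hcoeff, avoidingSeries_eq_prod hq,
        le_div_iff₀ (by positivity)]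
      have h := (hM ψ hψ).mul (CoeffBound.prod (s := (Finset.univ : Finset F)) ht0.le fun a _ =>
        hD.rescale (AddChar.norm_apply ψ (a ^ 2))) ht0.le
      rw [Finset.card_univ, hq] at h
      exact h.norm_coeff_mul_pow_le ht0.le n
  have hlimsum : (q : ℂ)⁻¹ * ∑ ψ : AddChar F ℂ, ψ (-k) * lim ψ =
      ((1 / (q : ℝ) * c ^ (q - 1) : ℝ) : ℂ) := by
    rw [Finset.sum_eq_single 0 (fun ψ _ h => by simp [hlim, h]) (by simp)]
    simp [hlim]
  have key : ((betaGL F n k - 1 / (q : ℝ) * c ^ (q - 1) : ℝ) : ℂ) =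
      (q : ℂ)⁻¹ * ∑ ψ : AddChar F ℂ, ψ (-k) * (avoidingSum ψ Finset.univ n - lim ψ) := by
    rw [Complex.ofReal_sub, ← hlimsum, betaGL_eq_sum hq, ← mul_sub, ← Finset.sum_sub_distrib]
    simp only [mul_sub]
  rw [abs_sub_comm, ← Real.norm_eq_abs, ← Complex.norm_real, key, norm_mul, norm_inv,
    Complex.norm_natCast, inv_mul_le_iff₀ hq0]
  calc _ ≤ ∑ ψ : AddChar F ℂ, ‖ψ (-k) * (avoidingSum ψ Finset.univ n - lim ψ)‖ := norm_sum_le _ _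
    _ ≤ ∑ _ψ : AddChar F ℂ, M * D ^ q / t ^ n := by
      refine Finset.sum_le_sum fun ψ _ => ?_
      rw [norm_mul, AddChar.norm_apply, one_mul]
      exact hbound ψ
    _ = q * (M * D ^ q / t ^ n) := by
      rw [Finset.sum_const, nsmul_eq_mul, Finset.card_univ, AddChar.card_eq, hq]

end Limit

section Majorant

open PowerSeries hiding X coeff

theorem sum_two_rpow_neg_sq_le (N : ℕ) :
    ∑ k ∈ Finset.range N, (2 : ℝ) ^ (-((k : ℝ) ^ 2) / 2) ≤ 17 / 8 := by
  have hterm (k : ℕ) : (2 : ℝ) ^ (-((k : ℝ) ^ 2) / 2) ≤ 2 * (9 / 25) ^ k := by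
    refine le_of_sq_le_sq ?_ (by positivity)
    have h1 : ((2 : ℝ) ^ (-((k : ℝ) ^ 2) / 2)) ^ 2 = (2 : ℝ) ^ (-((k : ℝ) ^ 2)) := by
      rw [← Real.rpow_natCast _ 2, ← Real.rpow_mul (by norm_num)]
      norm_num
    have h2 : -((k : ℝ) ^ 2) ≤ 2 + -3 * k := by
      rcases k with _ | _ | k
      · norm_num
      · norm_num
      · push_cast
        nlinarith [(Nat.cast_nonneg k : (0 : ℝ) ≤ k)]
    calc _ = (2 : ℝ) ^ (-((k : ℝ) ^ 2)) := h1
      _ ≤ (2 : ℝ) ^ (2 + -3 * (k : ℝ)) := Real.rpow_le_rpow_of_exponent_le (by norm_num) h2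
      _ = 4 * (1 / 8) ^ k := by
        rw [Real.rpow_add (by norm_num), Real.rpow_mul (by norm_num), Real.rpow_natCast]
        norm_num
      _ ≤ 4 * (81 / 625) ^ k :=
        mul_le_mul_of_nonneg_left (pow_le_pow_left₀ (by norm_num) (by norm_num) k) (by norm_num)
      _ = (2 * (9 / 25) ^ k) ^ 2 := by
        rw [mul_pow, ← pow_mul, mul_comm k 2, pow_mul]
        norm_num
  have hsum (N : ℕ) : ∑ k ∈ Finset.range N, 2 * (9 / 25 : ℝ) ^ (k + 1) =
      9 / 8 - 25 / 8 * (9 / 25) ^ (N + 1) := by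
    induction N with
    | zero => norm_num
    | succ N ih =>
      rw [Finset.sum_range_succ, ih]
      ring
  rcases N with _ | N
  · norm_num
  rw [Finset.sum_range_succ']
  have h3 := Finset.sum_le_sum fun k (_ : k ∈ Finset.range N) => hterm (k + 1)
  rw [hsum] at h3
  have h4 : (0 : ℝ) ≤ 25 / 8 * (9 / 25) ^ (N + 1) := by positivity
  norm_num at h3 ⊢
  linarith

theorem sum_two_rpow_neg_sub_sq_le (x : ℝ) (N : ℕ) :
    ∑ j ∈ Finset.range N, (2 : ℝ) ^ (-((j : ℝ) - x) ^ 2 / 2) ≤ 17 / 4 := by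
  set m := ⌈x⌉₊ with hm
  have hle (k : ℕ) (y : ℝ) (h : (k : ℝ) ≤ |y|) :
      (2 : ℝ) ^ (-y ^ 2 / 2) ≤ (2 : ℝ) ^ (-((k : ℝ) ^ 2) / 2) := by
    refine Real.rpow_le_rpow_of_exponent_le (by norm_num) ?_
    have : (k : ℝ) ^ 2 ≤ y ^ 2 := by
      rw [← sq_abs y]
      gcongr
    linarith
  calc _ ≤ ∑ j ∈ Finset.range (m + N), (2 : ℝ) ^ (-((j : ℝ) - x) ^ 2 / 2) :=
        Finset.sum_le_sum_of_subset_of_nonneg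
          (Finset.range_mono (Nat.le_add_left N m)) fun _ _ _ => by positivity
    _ = ∑ j ∈ Finset.range m, (2 : ℝ) ^ (-((j : ℝ) - x) ^ 2 / 2) +
        ∑ j ∈ Finset.range N, (2 : ℝ) ^ (-(((m + j : ℕ) : ℝ) - x) ^ 2 / 2) :=
        Finset.sum_range_add _ _ _
    _ ≤ ∑ j ∈ Finset.range m, (2 : ℝ) ^ (-(((m - 1 - j : ℕ) : ℝ) ^ 2) / 2) +
        ∑ j ∈ Finset.range N, (2 : ℝ) ^ (-((j : ℝ) ^ 2) / 2) := by
        refine add_le_add (Finset.sum_le_sum fun j hj => ?_) (Finset.sum_le_sum fun j _ => ?_)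
        · refine hle _ _ ?_
          have hj' := Finset.mem_range.1 hj
          have hx : (m : ℝ) < x + 1 := Nat.ceil_lt_add_one (by
            by_contra! h
            rw [Nat.ceil_eq_zero.2 h.le] at hm
            omega)
          rw [Nat.cast_sub (by omega), Nat.cast_sub (by omega), abs_sub_comm]
          refine le_trans ?_ (le_abs_self _)
          push_cast
          linarith
        · refine hle _ _ (le_trans ?_ (le_abs_self _))
          push_cast
          linarith [Nat.le_ceil x]
    _ ≤ 17 / 8 + 17 / 8 := by
        rw [Finset.sum_range_reflect (fun j : ℕ => (2 : ℝ) ^ (-((j : ℝ) ^ 2) / 2))]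
        exact add_le_add (sum_two_rpow_neg_sq_le _) (sum_two_rpow_neg_sq_le _)
    _ = 17 / 4 := by norm_num

theorem sum_rpow_le {q : ℝ} (hq : 2 ≤ q) (x : ℝ) (N : ℕ) :
    ∑ j ∈ Finset.range N, q ^ (-((j : ℝ) ^ 2) / 2 + x * j) ≤ 17 / 4 * q ^ (x ^ 2 / 2) := by
  have hq0 : 0 < q := by linarith
  refine le_trans ?_ (mul_le_mul_of_nonneg_right (sum_two_rpow_neg_sub_sq_le x N)
    (by positivity))
  rw [Finset.sum_mul]
  refine Finset.sum_le_sum fun j _ => ?_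
  have h1 : -((j : ℝ) ^ 2) / 2 + x * j = -((j : ℝ) - x) ^ 2 / 2 + x ^ 2 / 2 := by ring
  rw [h1, Real.rpow_add hq0]
  refine mul_le_mul_of_nonneg_right ?_ (by positivity)
  exact Real.rpow_le_rpow_of_nonpos (by norm_num) hq (by
    have := sq_nonneg ((j : ℝ) - x)
    linarith)

theorem coeffBound_of_norm_coeff_le {q : ℝ} (hq : 2 ≤ q) {f : PowerSeries ℂ} (u s : ℝ)
    (hf : ∀ j : ℕ, ‖PowerSeries.coeff j f‖ ≤ 4 * q ^ (-((j : ℝ) ^ 2) / 2 + u * j)) :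
    CoeffBound f (q ^ s) (17 * q ^ ((s + u) ^ 2 / 2)) := by
  have hq0 : 0 < q := by linarith
  intro N
  calc _ ≤ ∑ j ∈ Finset.range N, 4 * q ^ (-((j : ℝ) ^ 2) / 2 + (s + u) * j) := by
        refine Finset.sum_le_sum fun j _ => ?_
        refine (mul_le_mul_of_nonneg_right (hf j) (by positivity)).trans_eq ?_
        rw [← Real.rpow_natCast (q ^ s), ← Real.rpow_mul hq0.le, mul_assoc, ← Real.rpow_add hq0]
        congr 2
        ring
    _ ≤ 4 * (17 / 4 * q ^ ((s + u) ^ 2 / 2)) := by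
        rw [← Finset.mul_sum]
        gcongr
        exact sum_rpow_le hq _ N
    _ = _ := by ring

theorem coeffBound_eulerProdSeries {q : ℝ} (hq : 2 ≤ q) (s : ℝ) :
    CoeffBound (eulerProdSeries q) (q ^ s) (17 * q ^ ((s - 1 / 2) ^ 2 / 2)) := by
  have hq0 : 0 < q := by linarith
  rw [sub_eq_add_neg]
  refine coeffBound_of_norm_coeff_le hq _ _ fun j => ?_
  have hP := qProd_pos hq j
  simp only [eulerProdSeries, coeff_mk, norm_mul, norm_pow, norm_neg, norm_one, one_pow, one_mul,
    norm_inv, Complex.norm_real, Real.norm_eq_abs, abs_of_pos hq0, abs_of_pos hP]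
  have h1 : (q⁻¹) ^ (j * (j + 1) / 2) = q ^ (-((j : ℝ) ^ 2) / 2 + -(1 / 2) * j) := by
    rw [← Real.rpow_natCast, Nat.cast_div (even_iff_two_dvd.1 (Nat.even_mul_succ_self j))
      (by norm_num), Real.inv_rpow hq0.le, ← Real.rpow_neg hq0.le]
    push_cast
    congr 1
    ring
  rw [h1, mul_comm]
  gcongr
  exact inv_qProd_le hq j

variable {F : Type*} [Field F] [Fintype F]

theorem coeffBound_avoidingSeries_empty {q : ℕ} (hq : Fintype.card F = q) {ψ : AddChar F ℂ}
    (hψ : ψ ≠ 0) (s : ℝ) :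
    CoeffBound (avoidingSeries ψ ∅) ((q : ℝ) ^ s) (17 * (q : ℝ) ^ (s ^ 2 / 2)) := by
  have hq2 : (2 : ℝ) ≤ q := by exact_mod_cast (hq ▸ Fintype.one_lt_card : 1 < q)
  have h : (s + 0) ^ 2 / 2 = s ^ 2 / 2 := by rw [add_zero]
  rw [← h]
  refine coeffBound_of_norm_coeff_le hq2 0 s fun j => ?_
  rw [avoidingSeries, coeff_mk, zero_mul, add_zero, mul_comm]
  refine (norm_avoidingSum_empty_le hq hψ j).trans ?_
  gcongr
  exact inv_qProd_le hq2 j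

theorem abs_betaGL_sub_le_rpow {q : ℕ} (hq : Fintype.card F = q) {c : ℝ}
    (hc : Tendsto (qProd q) atTop (nhds c)) {s : ℝ} (hs : 0 ≤ s) (n : ℕ) (k : F) :
    |1 / (q : ℝ) * c ^ (q - 1) - betaGL F n k| ≤
      17 * (q : ℝ) ^ (s ^ 2 / 2) * (17 * (q : ℝ) ^ ((s - 1 / 2) ^ 2 / 2)) ^ q /
        ((q : ℝ) ^ s) ^ n := by
  have hq2 : (2 : ℝ) ≤ q := by exact_mod_cast (hq ▸ Fintype.one_lt_card : 1 < q)
  have hone (y : ℝ) (hy : 0 ≤ y) : 1 ≤ 17 * (q : ℝ) ^ y := by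
    linarith [Real.one_le_rpow (by linarith : 1 ≤ (q : ℝ)) hy]
  exact abs_betaGL_sub_le hq hc (Real.one_le_rpow (by linarith) hs)
    (hone _ (by positivity)) (hone _ (by positivity))
    (fun ψ hψ => coeffBound_avoidingSeries_empty hq hψ s) (coeffBound_eulerProdSeries hq2 s) n k

end Majorant

section Numerics

theorem seventeen_pow_le_of_three_le {q n : ℕ} (hq : 3 ≤ q) (hn : 5 * (q - 1) ^ 2 ≤ n) :
    (17 : ℝ) ^ (q + 1) ≤ (q : ℝ) ^ ((2 * (q : ℝ) - 1) * n / (2 * ((q : ℝ) + 1))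
      + ((q : ℝ) - 1) / (4 * ((q : ℝ) + 1)) - (q : ℝ) / 8) := by
  have hq3 : (3 : ℝ) ≤ q := by exact_mod_cast hq
  have hcast : ((q - 1 : ℕ) : ℝ) = (q : ℝ) - 1 := by
    rw [Nat.cast_sub (by omega)]
    norm_num
  have hn' : 5 * ((q : ℝ) - 1) ^ 2 ≤ n := by
    rw [← hcast]
    exact_mod_cast hn
  have h1 : 5 / 8 * (n : ℝ) ≤ (2 * (q : ℝ) - 1) * n / (2 * ((q : ℝ) + 1)) := by
    rw [le_div_iff₀ (by positivity)]
    nlinarith [(Nat.cast_nonneg n : (0 : ℝ) ≤ n)]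
  have h2 : 0 ≤ ((q : ℝ) - 1) / (4 * ((q : ℝ) + 1)) := div_nonneg (by linarith) (by positivity)
  have h3 : ((6 * (q - 1) : ℕ) : ℝ) ≤ (2 * (q : ℝ) - 1) * n / (2 * ((q : ℝ) + 1))
      + ((q : ℝ) - 1) / (4 * ((q : ℝ) + 1)) - (q : ℝ) / 8 := by
    push_cast [hcast]
    nlinarith
  calc (17 : ℝ) ^ (q + 1) ≤ 17 ^ (2 * (q - 1)) := pow_le_pow_right₀ (by norm_num) (by omega)
    _ = (17 ^ 2) ^ (q - 1) := pow_mul _ _ _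
    _ ≤ (3 ^ 6) ^ (q - 1) := pow_le_pow_left₀ (by norm_num) (by norm_num) _
    _ = 3 ^ (6 * (q - 1)) := (pow_mul _ _ _).symm
    _ ≤ (q : ℝ) ^ (6 * (q - 1)) := pow_le_pow_left₀ (by norm_num) hq3 _
    _ ≤ _ := by
      rw [← Real.rpow_natCast]
      exact Real.rpow_le_rpow_of_exponent_le (by linarith) h3

theorem seventeen_pow_three_le {n : ℕ} (hn : 5 ≤ n) :
    (17 : ℝ) ^ 3 ≤ ((n : ℝ) + 1) ^ 2 * (2 : ℝ) ^ (3 * (n : ℝ) / 2 - 1 / 6) := by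
  have hn' : (5 : ℝ) ≤ n := by exact_mod_cast hn
  have h1 : (137 : ℝ) ≤ 2 ^ (22 / 3 : ℝ) := by
    refine le_of_pow_le_pow_left₀ (n := 3) (by norm_num) (by positivity) ?_
    rw [← Real.rpow_natCast (2 ^ (22 / 3 : ℝ)), ← Real.rpow_mul (by norm_num)]
    norm_num
  calc (17 : ℝ) ^ 3 ≤ (5 + 1) ^ 2 * 137 := by norm_num
    _ ≤ (5 + 1) ^ 2 * 2 ^ (22 / 3 : ℝ) := by gcongr
    _ ≤ _ := by
      gcongr
      · norm_num
      · linarith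

theorem majorant_le_gammaErr {q n : ℕ} (hq : 2 ≤ q) (hn : 5 * (q - 1) ^ 2 ≤ n) :
    (17 : ℝ) ^ (q + 1) * (q : ℝ) ^ (-((n : ℝ) ^ 2) / (2 * ((q : ℝ) + 1))
      - q * n / (2 * ((q : ℝ) + 1)) + q / 8) ≤ gammaErr q n := by
  have hq2 : (2 : ℝ) ≤ q := by exact_mod_cast hq
  have hq0 : (0 : ℝ) < q := by linarith
  set e : ℝ := -((n : ℝ) ^ 2) / (2 * ((q : ℝ) + 1)) + ((q : ℝ) - 1) * (n : ℝ) / (2 * ((q : ℝ) + 1))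
        + ((q : ℝ) - 1) / (4 * ((q : ℝ) + 1)) with he
  have h1 : (1 : ℝ) ≤ (q : ℝ) / ((q : ℝ) - 1) := by
    rw [one_le_div₀ (by linarith)]
    linarith
  have h2 : (1 : ℝ) ≤ Nat.choose (n + q - 2) (q - 2) := by
    exact_mod_cast Nat.choose_pos (by omega)
  refine le_trans ?_ (le_add_of_nonneg_left (by positivity))
  have hexp : -((n : ℝ) ^ 2) / (2 * ((q : ℝ) + 1)) - q * n / (2 * ((q : ℝ) + 1)) + q / 8 =
      e - ((2 * (q : ℝ) - 1) * n / (2 * ((q : ℝ) + 1))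
        + ((q : ℝ) - 1) / (4 * ((q : ℝ) + 1)) - (q : ℝ) / 8) := by
    rw [he]
    field_simp
    ring
  rw [hexp, Real.rpow_sub hq0, mul_div_assoc', div_le_iff₀ (by positivity), mul_right_comm]
  refine mul_le_mul_of_nonneg_right ?_ (by positivity)
  rcases hq.eq_or_lt with rfl | hq3
  · refine (seventeen_pow_three_le (by simpa using hn)).trans ?_
    rw [mul_assoc, mul_assoc]
    refine mul_le_mul_of_nonneg_left ?_ (by positivity)
    refine le_trans ?_ (le_mul_of_one_le_left (by positivity) h2)
    rw [← Real.rpow_natCast]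
    push_cast
    rw [show (2 : ℝ) / (2 - 1) = 2 by norm_num, ← Real.rpow_add (by norm_num)]
    refine Real.rpow_le_rpow_of_exponent_le (by norm_num) ?_
    norm_num
    linarith
  · refine (seventeen_pow_le_of_three_le hq3 hn).trans (le_mul_of_one_le_left (by positivity) ?_)
    refine one_le_mul_of_one_le_of_one_le (one_le_mul_of_one_le_of_one_le ?_ h2) (one_le_pow₀ h1)
    exact one_le_pow₀ (by linarith [(Nat.cast_nonneg n : (0 : ℝ) ≤ n)])

theorem rpow_majorant_eq {q : ℕ} (hq : 2 ≤ q) (n : ℕ) {s : ℝ} (hs : s = n / ((q : ℝ) + 1)) :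
    17 * (q : ℝ) ^ (s ^ 2 / 2) * (17 * (q : ℝ) ^ ((s - 1 / 2) ^ 2 / 2)) ^ q / ((q : ℝ) ^ s) ^ n =
      (17 : ℝ) ^ (q + 1) * (q : ℝ) ^ (-((n : ℝ) ^ 2) / (2 * ((q : ℝ) + 1))
        - q * n / (2 * ((q : ℝ) + 1)) + q / 8) := by
  have hq0 : (0 : ℝ) < q := by exact_mod_cast (by omega : 0 < q)
  have hexp : -((n : ℝ) ^ 2) / (2 * ((q : ℝ) + 1)) - q * n / (2 * ((q : ℝ) + 1)) + q / 8 =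
      s ^ 2 / 2 + (s - 1 / 2) ^ 2 / 2 * q - s * n := by
    rw [hs]
    field_simp
    ring
  rw [hexp, Real.rpow_sub hq0, Real.rpow_add hq0, Real.rpow_mul hq0.le, Real.rpow_mul hq0.le,
    Real.rpow_natCast, Real.rpow_natCast, mul_pow, pow_succ]
  ring

end Numerics

/-- For every `k ∈ F_q`, `β(n, q, k)` converges to `β(∞, q, k) = (1/q)·c(q)^{q−1}` as
`n → ∞`, and for every `n ≥ 5(q−1)²` and every `k ∈ F_q`,
`|β(∞, q, k) − β(n, q, k)| ≤ Γ(n, q)`. -/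
theorem stmt_16 (F : Type*) [Field F] [Fintype F] (q : ℕ) (hq : Fintype.card F = q) (c : ℝ)
    (hc : Tendsto (fun n : ℕ => ∏ i ∈ Finset.Icc 1 n, (1 - ((q : ℝ))⁻¹ ^ i)) atTop (nhds c)) :
    (∀ k : F, Tendsto (fun n : ℕ => betaGL F n k) atTop
        (nhds ((1 / (q : ℝ)) * c ^ (q - 1)))) ∧
    ∀ n : ℕ, 5 * (q - 1) ^ 2 ≤ n → ∀ k : F,
      |(1 / (q : ℝ)) * c ^ (q - 1) - betaGL F n k| ≤ gammaErr q n := by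
  have hq2 : 2 ≤ q := hq ▸ Fintype.one_lt_card
  have hq2' : (2 : ℝ) ≤ q := by exact_mod_cast hq2
  refine ⟨fun k => ?_, fun n hn k => ?_⟩
  · rw [tendsto_iff_norm_sub_tendsto_zero]
    have hlim : Tendsto (fun n : ℕ => 17 * (q : ℝ) ^ ((1 : ℝ) ^ 2 / 2) *
        (17 * (q : ℝ) ^ ((1 - 1 / 2 : ℝ) ^ 2 / 2)) ^ q / ((q : ℝ) ^ (1 : ℝ)) ^ n) atTop
        (nhds 0) := by
      refine tendsto_const_nhds.div_atTop (tendsto_pow_atTop_atTop_of_one_lt ?_)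
      rw [Real.rpow_one]
      linarith
    refine squeeze_zero (fun n => norm_nonneg _) (fun n => ?_) hlim
    rw [Real.norm_eq_abs, abs_sub_comm]
    exact abs_betaGL_sub_le_rpow hq hc zero_le_one n k
  · refine (abs_betaGL_sub_le_rpow hq hc (s := n / ((q : ℝ) + 1)) (by positivity) n k).trans ?_
    rw [rpow_majorant_eq hq2 n rfl]
    exact majorant_le_gammaErr hq2 hn
end
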